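/- arXiv:2605.11288 — 2 statements merged into one kernel-verified Lean document; each statement's English description precedes it below -/
import Mathlib

section
/- For every real η with 0 < η ≤ 1 there exist ε₀ > 0 and, for each ε ∈ (0, ε₀], an n₀ ∈ ℕ such that the following holds for all n ≥ n₀. Let G be a Hamiltonian n-vertex graph with minimum degree δ(G) ≥ n^{1−ε}, let 𝒞 be a Hamilton cycle of G, and let E₀ ⊆ E(𝒞) be a set of size |E₀| ≤ n^{1−η}. Then G has a Hamilton cycle 𝒞' such that E₀ ⊆ E(𝒞') and e(H_{𝒞'}) ≥ n^{2−η}. -/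
/-- `C` is a Hamilton cycle on its (whole) vertex set: a connected 2-regular graph. -/
def IsHamCycleOn {V : Type*} (C : SimpleGraph V) : Prop :=
  C.Connected ∧ ∀ v : V, (C.neighborSet v).ncard = 2

/-- Adjacency in the auxiliary graph `H_C`: two distinct non-incident edges `e, e'` of the
2-factor (or Hamilton cycle) `C` are adjacent iff `G` contains a 4-cycle containing both
`e` and `e'` and no other edge of `C`. -/
def AuxAdj {V : Type*} (G C : SimpleGraph V) (e e' : Sym2 V) : Prop :=
  e ∈ C.edgeSet ∧ e' ∈ C.edgeSet ∧ e ≠ e' ∧ (∀ v : V, ¬ (v ∈ e ∧ v ∈ e')) ∧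
    ∃ x y z w : V, e = s(x, y) ∧ e' = s(z, w) ∧
      G.Adj y z ∧ G.Adj w x ∧ ¬ C.Adj y z ∧ ¬ C.Adj w x

/-- `e(H_C)`: the number of edges of the auxiliary graph `H_C`, i.e. the number of
(unordered) pairs of edges of `C` which are adjacent in `H_C`. -/
noncomputable def auxEdgeCount {V : Type*} (G C : SimpleGraph V) : ℕ :=
  ({q : Sym2 (Sym2 V) | ∃ e e' : Sym2 V, AuxAdj G C e e' ∧ q = s(e, e')}).ncard

section

open Finset

/-- A permutation with a single orbit has no short cycles. -/
lemma Equiv.Perm.apply_apply_ne_of_forall_sameCycle {V : Type*} [Fintype V] {τ : Equiv.Perm V}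
    (hτ : ∀ u v, τ.SameCycle u v) (hcard : 3 ≤ Fintype.card V) (v : V) : τ (τ v) ≠ v := by
  classical
  intro h
  have hsub : (univ : Finset V) ⊆ {v, τ v} := by
    intro w _
    have hmem : ∀ k : ℕ, (τ ^ k) v = v ∨ (τ ^ k) v = τ v := by
      intro k
      induction k with
      | zero => simp
      | succ k ih =>
        rw [pow_succ', Equiv.Perm.mul_apply]
        rcases ih with ih | ih <;> rw [ih]
        · exact Or.inr rfl
        · exact Or.inl h
    obtain ⟨j, -, -, hj⟩ := (hτ v w).exists_pow_eq''
    have := hmem j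
    simp only [mem_insert, mem_singleton]
    grind
  have := (card_le_card hsub).trans card_le_two
  rw [card_univ] at this
  omega

/-- A Hamilton cycle is traversed by a permutation with a single orbit. -/
lemma IsHamCycleOn.exists_perm {V : Type*} [Fintype V] {C : SimpleGraph V}
    (hC : IsHamCycleOn C) :
    3 ≤ Fintype.card V ∧ ∃ τ : Equiv.Perm V, (∀ u v, τ.SameCycle u v) ∧
      ∀ u v, C.Adj u v ↔ τ u = v ∨ τ v = u := by
  classical
  obtain ⟨hconn, hdeg⟩ := hC
  obtain ⟨v⟩ := hconn.nonempty
  have hcyc : C.IsCycles := fun w _ => hdeg w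
  have hne : (C.neighborSet v).Nonempty := by
    refine Set.nonempty_of_ncard_ne_zero ?_
    rw [hdeg]; norm_num
  obtain ⟨p, hp, hverts⟩ := hcyc.exists_cycle_toSubgraph_verts_eq_connectedComponentSupp
    (c := C.connectedComponentMk v) (by simp) hne
  have hmem : ∀ w, w ∈ p.support.tail := by
    intro w
    have : w ∈ p.toSubgraph.verts := by
      rw [hverts]
      simpa [SimpleGraph.ConnectedComponent.mem_supp_iff] using hconn.preconnected w v
    rw [SimpleGraph.Walk.mem_verts_toSubgraph] at this
    by_cases hw : w = v
    · subst hw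
      exact SimpleGraph.Walk.end_mem_tail_support hp.not_nil
    · rw [SimpleGraph.Walk.mem_support_iff] at this
      tauto
  have hnd : p.support.tail.Nodup := hp.support_nodup
  set l := p.support.tail with hl
  have hlen : l.length = p.length := by simp [hl]
  have hcard : Fintype.card V = l.length := by
    rw [← List.toFinset_card_of_nodup hnd, ← card_univ]
    congr 1
    ext w
    simp [hmem w]
  have h3 : 3 ≤ Fintype.card V := by
    rw [hcard, hlen]; exact hp.three_le_length
  have hget : ∀ i (hi : i < l.length), l[i] = p.getVert (i + 1) := by
    intro i hi
    simp [hl, SimpleGraph.Walk.support_getElem_eq_getVert]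
  have hsame : ∀ a b, l.formPerm.SameCycle a b := fun a b =>
    hnd.isCycleOn_formPerm.2 (hmem a) (hmem b)
  have hadj : ∀ w, C.Adj w (l.formPerm w) := by
    intro w
    obtain ⟨i, hi, rfl⟩ := List.getElem_of_mem (hmem w)
    rw [List.formPerm_apply_getElem _ hnd]
    rcases Nat.lt_or_ge (i + 1) l.length with h | h
    · simp only [Nat.mod_eq_of_lt h]
      rw [hget, hget]
      exact p.adj_getVert_succ (by omega)
    · have hi' : i + 1 = l.length := by omega
      simp only [hi', Nat.mod_self]
      rw [hget, hget, hi', hlen, SimpleGraph.Walk.getVert_length]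
      simpa using p.adj_getVert_succ (i := 0) (by omega)
  refine ⟨h3, l.formPerm, hsame, fun a b => ⟨fun h => ?_, ?_⟩⟩
  · have hsub : ({l.formPerm a, l.formPerm⁻¹ a} : Set V) ⊆ C.neighborSet a := by
      rintro w (rfl | rfl)
      · exact hadj a
      · have := hadj (l.formPerm⁻¹ a)
        rw [show l.formPerm (l.formPerm⁻¹ a) = a from l.formPerm.apply_symm_apply a] at this
        exact this.symm
    have hne2 : l.formPerm a ≠ l.formPerm⁻¹ a := by
      intro h
      rw [Equiv.Perm.eq_inv_iff_eq] at h
      exact Equiv.Perm.apply_apply_ne_of_forall_sameCycle hsame h3 a h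
    have heq := Set.eq_of_subset_of_ncard_le hsub (by rw [hdeg, Set.ncard_pair hne2])
      (Set.toFinite _)
    have : b ∈ C.neighborSet a := h
    rw [← heq] at this
    rcases this with h | h
    · exact Or.inl h.symm
    · right
      rw [h]
      exact l.formPerm.apply_symm_apply a
  · rintro (rfl | rfl)
    · exact hadj a
    · exact (hadj b).symm

/-- The undirected graph traversed by a permutation. -/
def Equiv.Perm.cycleGraph {V : Type*} (τ : Equiv.Perm V) : SimpleGraph V where
  Adj u v := u ≠ v ∧ (τ u = v ∨ τ v = u)
  symm := ⟨fun _ _ h => ⟨h.1.symm, h.2.symm⟩⟩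
  loopless := ⟨fun _ h => h.1 rfl⟩

lemma Equiv.Perm.isHamCycleOn_cycleGraph {V : Type*} [Fintype V] {τ : Equiv.Perm V}
    (hτ : ∀ u v, τ.SameCycle u v) (hcard : 3 ≤ Fintype.card V) : IsHamCycleOn τ.cycleGraph := by
  classical
  have hfix : ∀ v, τ v ≠ v := fun v h =>
    Equiv.Perm.apply_apply_ne_of_forall_sameCycle hτ hcard v (by rw [h, h])
  have hadj : ∀ v, τ.cycleGraph.Adj v (τ v) := fun v => ⟨(hfix v).symm, Or.inl rfl⟩
  refine ⟨?_, fun v => ?_⟩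
  · have : Nonempty V := Fintype.card_pos_iff.mp (by omega)
    refine ⟨fun u v => ?_⟩
    obtain ⟨k, -, -, rfl⟩ := (hτ u v).exists_pow_eq''
    induction k with
    | zero => simp
    | succ k ih =>
      rw [pow_succ', Equiv.Perm.mul_apply]
      exact ih.trans (hadj _).reachable
  · have : τ.cycleGraph.neighborSet v = {τ v, τ⁻¹ v} := by
      ext w
      simp only [SimpleGraph.mem_neighborSet, Equiv.Perm.cycleGraph, Set.mem_insert_iff,
        Set.mem_singleton_iff, Equiv.Perm.eq_inv_iff_eq]
      constructor
      · rintro ⟨-, h | h⟩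
        exacts [Or.inl h.symm, Or.inr h]
      · rintro (rfl | h)
        · exact ⟨(hfix v).symm, Or.inl rfl⟩
        · exact ⟨fun hvw => hfix v (by rw [← hvw] at h; exact h), Or.inr h⟩
    rw [this, Set.ncard_pair]
    intro h
    rw [Equiv.Perm.eq_inv_iff_eq] at h
    exact Equiv.Perm.apply_apply_ne_of_forall_sameCycle hτ hcard v h

/-- Composing with a transposition of two points on different cycles merges these cycles. -/
lemma Equiv.Perm.sameCycle_apply_mul_swap {V : Type*} [Finite V] [DecidableEq V]
    {f : Equiv.Perm V} {x y : V} (hxy : ¬ f.SameCycle x y) :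
    (f * Equiv.swap x y).SameCycle (f x) x := by
  classical
  have hex : ∃ k : ℕ, (f ^ k) (f x) = x := by
    obtain ⟨k, -, -, hk⟩ := (show f.SameCycle (f x) x by simp [Equiv.Perm.SameCycle.rfl]).exists_pow_eq''
    exact ⟨k, hk⟩
  have hpath : ∀ j ≤ Nat.find hex, ((f * Equiv.swap x y) ^ j) (f x) = (f ^ j) (f x) := by
    intro j
    induction j with
    | zero => simp
    | succ j ih =>
      intro hj
      rw [pow_succ', Equiv.Perm.mul_apply, ih (by omega), pow_succ', Equiv.Perm.mul_apply,
        Equiv.Perm.mul_apply, Equiv.swap_apply_of_ne_of_ne]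
      · exact Nat.find_min hex (by omega)
      · intro h
        apply hxy
        rw [← h]
        simp [Equiv.Perm.SameCycle.rfl]
  refine ⟨(Nat.find hex : ℕ), ?_⟩
  rw [zpow_natCast, hpath _ le_rfl]
  exact Nat.find_spec hex

lemma Equiv.Perm.sameCycle_mul_swap {V : Type*} [Finite V] [DecidableEq V]
    {f : Equiv.Perm V} {x y : V} (hxy : ¬ f.SameCycle x y) :
    (f * Equiv.swap x y).SameCycle x y ∧
      ∀ u v, f.SameCycle u v → (f * Equiv.swap x y).SameCycle u v := by
  set g := f * Equiv.swap x y with hg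
  have hx : g.SameCycle (f x) x := Equiv.Perm.sameCycle_apply_mul_swap hxy
  have hy : g.SameCycle (f y) y := by
    rw [hg, Equiv.swap_comm]
    exact Equiv.Perm.sameCycle_apply_mul_swap (fun h => hxy h.symm)
  have hgx : g.SameCycle (f x) y := ⟨-1, by
    rw [zpow_neg_one, Equiv.Perm.inv_eq_iff_eq, hg]; simp⟩
  have hstep : ∀ u, g.SameCycle u (f u) := by
    intro u
    by_cases h1 : u = x
    · subst h1; exact hx.symm
    by_cases h2 : u = y
    · subst h2; exact hy.symm
    exact ⟨1, by rw [zpow_one, hg, Equiv.Perm.mul_apply, Equiv.swap_apply_of_ne_of_ne h1 h2]⟩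
  refine ⟨hx.symm.trans hgx, fun u v huv => ?_⟩
  obtain ⟨k, -, -, rfl⟩ := huv.exists_pow_eq''
  induction k with
  | zero => simp [Equiv.Perm.SameCycle.rfl]
  | succ k ih =>
    rw [pow_succ', Equiv.Perm.mul_apply]
    exact (ih ⟨k, by simp⟩).trans (hstep _)

/-- Rerouting a cyclic permutation `τ`: the arcs leaving the points `e i` are permuted according to
`σ`, where the points come in pairs such that no other chosen point lies between the two members
of a pair.  The choice within each pair can be made such that the result is again cyclic. -/
lemma Equiv.Perm.exists_reroute {V ι : Type*} [Fintype V] {τ : Equiv.Perm V}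
    (hτ : ∀ u v, τ.SameCycle u v) (σ : Equiv.Perm ι) (e : ι × Bool ↪ V)
    (hbetween : ∀ i, ∃ k : ℕ, (τ ^ k) (τ (e (i, false))) = e (i, true) ∧
      ∀ j < k, (τ ^ j) (τ (e (i, false))) ∉ Set.range e) :
    ∃ τ' : Equiv.Perm V, (∀ u v, τ'.SameCycle u v) ∧ (∀ v, v ∉ Set.range e → τ' v = τ v) ∧
      ∀ i c, ∃ c', τ' (e (σ i, c)) = τ (e (i, c')) := by
  classical
  let A : Finset (Equiv.Perm V) := univ.filter fun τ' =>
    (∀ v, v ∉ Set.range e → τ' v = τ v) ∧ ∀ i c, ∃ c', τ' (e (σ i, c)) = τ (e (i, c'))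
  have hA : A.Nonempty := by
    let ρ : Equiv.Perm (ι × Bool) := Equiv.prodCongr σ (Equiv.refl Bool)
    refine ⟨τ * (ρ⁻¹).viaEmbedding e, ?_⟩
    simp only [A, mem_filter, mem_univ, true_and]
    refine ⟨fun v hv => ?_, fun i c => ⟨c, ?_⟩⟩
    · rw [Equiv.Perm.mul_apply, Equiv.Perm.viaEmbedding_apply_of_notMem _ _ _ hv]
    · rw [Equiv.Perm.mul_apply, Equiv.Perm.viaEmbedding_apply]
      congr 2
      rw [Equiv.Perm.inv_eq_iff_eq]
      rfl
  obtain ⟨f, hfA, hmax⟩ := A.exists_max_image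
    (fun f => (univ.filter fun q : V × V => f.SameCycle q.1 q.2).card) hA
  simp only [A, mem_filter, mem_univ, true_and] at hfA
  obtain ⟨hoff, hon⟩ := hfA
  refine ⟨f, ?_, hoff, hon⟩
  have hpair : ∀ i, f.SameCycle (e (i, false)) (e (i, true)) := by
    intro i
    by_contra hne
    obtain ⟨h1, h2⟩ := Equiv.Perm.sameCycle_mul_swap hne
    have hmem : f * Equiv.swap (e (i, false)) (e (i, true)) ∈ A := by
      simp only [A, mem_filter, mem_univ, true_and]
      refine ⟨fun v hv => ?_, fun j c => ?_⟩
      · rw [Equiv.Perm.mul_apply, Equiv.swap_apply_of_ne_of_ne, hoff v hv]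
        · rintro rfl; exact hv ⟨_, rfl⟩
        · rintro rfl; exact hv ⟨_, rfl⟩
      · rw [Equiv.Perm.mul_apply]
        by_cases hj : σ j = i
        · subst hj
          cases c
          · rw [Equiv.swap_apply_left]; exact hon j true
          · rw [Equiv.swap_apply_right]; exact hon j false
        · rw [Equiv.swap_apply_of_ne_of_ne]
          · exact hon j c
          · intro h; exact hj (congrArg Prod.fst (e.injective h))
          · intro h; exact hj (congrArg Prod.fst (e.injective h))
    refine absurd (hmax _ hmem) (not_le.mpr (card_lt_card ?_))
    refine ⟨fun q hq => ?_, fun hsub => hne ?_⟩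
    · simp only [mem_filter, mem_univ, true_and] at hq ⊢
      exact h2 _ _ hq
    · have := @hsub (e (i, false), e (i, true)) (by simpa using h1)
      simpa using this
  have hsource : ∀ i c, f.SameCycle (τ (e (i, c))) (e (σ i, false)) := by
    intro i c
    obtain ⟨c₀, h₀⟩ := hon i false
    obtain ⟨c₁, h₁⟩ := hon i true
    have hc : c₀ ≠ c₁ := by
      rintro rfl
      have := f.injective (h₀.trans h₁.symm)
      simpa using e.injective this
    have k₀ : f.SameCycle (τ (e (i, c₀))) (e (σ i, false)) := by
      rw [← h₀]; simp [Equiv.Perm.SameCycle.rfl]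
    have k₁ : f.SameCycle (τ (e (i, c₁))) (e (σ i, false)) := by
      rw [← h₁]
      simpa using (hpair (σ i)).symm
    have hbool : ∀ c c₀ c₁ : Bool, c₀ ≠ c₁ → c = c₀ ∨ c = c₁ := by decide
    rcases hbool c c₀ c₁ hc with rfl | rfl
    · exact k₀
    · exact k₁
  have hstep : ∀ v, f.SameCycle v (τ v) := by
    intro v
    by_cases hv : v ∈ Set.range e
    · obtain ⟨⟨i, c⟩, rfl⟩ := hv
      obtain ⟨k, hk, hbet⟩ := hbetween i
      have hrun : ∀ j ≤ k, f.SameCycle (τ (e (i, false))) ((τ ^ j) (τ (e (i, false)))) := by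
        intro j
        induction j with
        | zero => simp [Equiv.Perm.SameCycle.rfl]
        | succ j ih =>
          intro hj
          refine (ih (by omega)).trans ?_
          rw [pow_succ', Equiv.Perm.mul_apply, ← hoff _ (hbet j (by omega))]
          simp [Equiv.Perm.SameCycle.rfl]
      have h1 := hrun k le_rfl
      rw [hk] at h1
      have h2 : f.SameCycle (e (i, c)) (e (i, true)) := by
        cases c
        · exact hpair i
        · exact Equiv.Perm.SameCycle.rfl
      exact h2.trans (h1.symm.trans ((hsource i false).trans (hsource i c).symm))
    · rw [← hoff v hv]
      simp [Equiv.Perm.SameCycle.rfl]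
  intro u v
  obtain ⟨k, -, -, rfl⟩ := (hτ u v).exists_pow_eq''
  induction k with
  | zero => simp [Equiv.Perm.SameCycle.rfl]
  | succ k ih =>
    rw [pow_succ', Equiv.Perm.mul_apply]
    exact ih.trans (hstep _)

/-- An averaging argument: if the average of `f` is large, then `f` is large on a large set. -/
lemma Finset.card_le_mul_card_filter_of_le_sum {α : Type*} {S : Finset α} {f : α → ℕ}
    {M W b : ℕ} (hM : 0 < M) (hf : ∀ i ∈ S, f i ≤ M) (hS : S.card ≤ W)
    (hsum : W * M ≤ b * ∑ i ∈ S, f i) :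
    W ≤ 2 * b * (S.filter fun i => M ≤ 2 * b * f i).card := by
  have h1 : 2 * b * ∑ i ∈ S.filter (fun i => M ≤ 2 * b * f i), f i ≤
      2 * b * (S.filter fun i => M ≤ 2 * b * f i).card * M := by
    rw [mul_assoc (2 * b)]
    refine Nat.mul_le_mul_left _ ?_
    rw [← smul_eq_mul]
    exact sum_le_card_nsmul _ _ _ fun i hi => hf i (mem_filter.mp hi).1
  have h2 : 2 * b * ∑ i ∈ S.filter (fun i => ¬ M ≤ 2 * b * f i), f i ≤ W * M := by
    rw [mul_sum]
    refine (sum_le_card_nsmul _ _ M fun i hi => ?_).trans ?_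
    · exact (not_le.mp (mem_filter.mp hi).2).le
    · rw [smul_eq_mul]
      exact Nat.mul_le_mul_right _ ((card_filter_le _ _).trans hS)
  have h3 := sum_filter_add_sum_filter_not S (fun i => M ≤ 2 * b * f i) f
  refine Nat.le_of_mul_le_mul_right ?_ hM
  nlinarith

/-- A greedy choice of `T` elements of `Y`, pairwise free of conflicts. -/
lemma exists_pairwise_not_of_card {Ω : Type*} [Fintype Ω] [DecidableEq Ω] {K : Ω → Ω → Prop}
    [DecidableRel K] (hrefl : ∀ ω, K ω ω) (hsymm : ∀ ω ω', K ω ω' → K ω' ω) {d : ℕ}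
    (hd : ∀ ω, (univ.filter (K ω)).card ≤ d) (Y I : Finset Ω)
    (hI : (I : Set Ω).Pairwise fun ω ω' => ¬ K ω ω') (T : ℕ) (hT : (I.card + T) * d < Y.card) :
    ∃ J ⊆ Y, J.card = T ∧ Disjoint I J ∧
      ((I ∪ J : Finset Ω) : Set Ω).Pairwise fun ω ω' => ¬ K ω ω' := by
  induction T with
  | zero => exact ⟨∅, empty_subset _, rfl, disjoint_empty_right _, by simpa using hI⟩
  | succ T ih =>
    obtain ⟨J, hJY, hJT, hdisj, hpair⟩ := ih (lt_of_le_of_lt (by gcongr; omega) hT)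
    have hcard : ((I ∪ J).biUnion fun ω => univ.filter (K ω)).card < Y.card := by
      refine lt_of_le_of_lt (card_biUnion_le_card_mul _ _ d fun ω _ => hd ω) ?_
      rw [card_union_of_disjoint hdisj, hJT]
      exact lt_of_le_of_lt (by gcongr; omega) hT
    obtain ⟨ω, hωY, hω⟩ := exists_mem_notMem_of_card_lt_card hcard
    have hfree : ∀ ω' ∈ I ∪ J, ¬ K ω' ω := fun ω' h' hK =>
      hω (mem_biUnion.mpr ⟨ω', h', by simpa using hK⟩)
    have hωI : ω ∉ I ∪ J := fun h => hfree ω h (hrefl ω)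
    rw [mem_union, not_or] at hωI
    refine ⟨insert ω J, insert_subset hωY hJY, by rw [card_insert_of_notMem hωI.2, hJT],
      disjoint_insert_right.mpr ⟨hωI.1, hdisj⟩, ?_⟩
    rw [union_insert, coe_insert, Set.pairwise_insert]
    exact ⟨hpair, fun b hb _ => ⟨fun h => hfree b hb (hsymm _ _ h), hfree b hb⟩⟩

/-- In a dense relation `R` with a sparse conflict relation `K`, there are two conflict-free sets
of `T` elements each, such that `R` is dense between them. -/
lemma exists_dense_pair_of_card {Ω : Type*} [Fintype Ω] [DecidableEq Ω] {K R : Ω → Ω → Prop}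
    [DecidableRel K] [DecidableRel R] (hrefl : ∀ ω, K ω ω) (hsymm : ∀ ω ω', K ω ω' → K ω' ω)
    {d B T : ℕ} (hd : ∀ ω, (univ.filter (K ω)).card ≤ d) (S : Finset Ω)
    (hR : Fintype.card Ω ^ 2 ≤ B * ∑ ω ∈ S, (S.filter (R ω)).card) (hT0 : 0 < T)
    (hT : 8 * B * T * d < Fintype.card Ω) :
    ∃ I J : Finset Ω, I ⊆ S ∧ J ⊆ S ∧
      ((I ∪ J : Finset Ω) : Set Ω).Pairwise (fun ω ω' => ¬ K ω ω') ∧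
      Disjoint I J ∧ T ^ 2 ≤ 4 * B * ∑ ω ∈ J, (I.filter fun ω' => R ω' ω).card := by
  set W := Fintype.card Ω with hW
  have hSW : S.card ≤ W := card_le_univ S
  have hY₁ := card_le_mul_card_filter_of_le_sum (S := S) (f := fun ω => (S.filter (R ω)).card)
    (M := W) (W := W) (b := B) (by omega)
    (fun i _ => (card_filter_le _ _).trans hSW) hSW (by rw [← sq]; exact hR)
  set Y₁ := S.filter fun ω => W ≤ 2 * B * (S.filter (R ω)).card with hY₁def
  obtain ⟨I, hIY, hIT, -, hIpair⟩ := exists_pairwise_not_of_card hrefl hsymm hd Y₁ ∅ (by simp) T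
    (by
      rw [card_empty, zero_add]
      by_contra hcon
      rw [not_lt] at hcon
      have : 2 * B * Y₁.card ≤ 2 * B * (T * d) := Nat.mul_le_mul_left _ hcon
      nlinarith)
  rw [empty_union] at hIpair
  have hsum : W * T ≤ 2 * B * ∑ ω ∈ S, (I.filter fun ω' => R ω' ω).card := by
    have hswap : ∑ ω ∈ S, (I.filter fun ω' => R ω' ω).card = ∑ ω' ∈ I, (S.filter (R ω')).card := by
      simp only [card_filter]
      exact sum_comm
    rw [hswap, mul_sum, mul_comm, ← hIT, ← smul_eq_mul]
    exact card_nsmul_le_sum _ _ _ fun ω hω => (mem_filter.mp (hIY hω)).2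
  have hY₂ := card_le_mul_card_filter_of_le_sum (S := S)
    (f := fun ω => (I.filter fun ω' => R ω' ω).card) (M := T) (W := W) (b := 2 * B) hT0
    (fun i _ => (card_filter_le _ _).trans hIT.le) hSW hsum
  set Y₂ := S.filter fun ω => T ≤ 2 * (2 * B) * (I.filter fun ω' => R ω' ω).card with hY₂def
  obtain ⟨J, hJY, hJT, hIJ, hpair⟩ := exists_pairwise_not_of_card hrefl hsymm hd Y₂ I hIpair T
    (by
      rw [hIT]
      by_contra hcon
      rw [not_lt] at hcon
      have : 2 * (2 * B) * Y₂.card ≤ 2 * (2 * B) * ((T + T) * d) := Nat.mul_le_mul_left _ hcon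
      nlinarith)
  refine ⟨I, J, hIY.trans (filter_subset _ _), hJY.trans (filter_subset _ _), hpair, hIJ, ?_⟩
  rw [sq, mul_sum]
  nth_rw 1 [← hJT]
  rw [← smul_eq_mul]
  refine card_nsmul_le_sum _ _ _ fun ω hω => ?_
  have := (mem_filter.mp (hJY hω)).2
  linarith

lemma Finset.sum_pow_four_le_sum_four_cycles {P : Type*} [Fintype P] (g : P → P → ℕ) :
    (∑ p, ∑ q, g p q) ^ 4 ≤ Fintype.card P ^ 4 *
      ∑ p, ∑ p', ∑ q, ∑ q', (g p q * g p' q') * (g p q' * g p' q) := by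
  set N := Fintype.card P with hN
  have h1 : (∑ p, ∑ q, g p q) ^ 2 ≤ N * ∑ q, (∑ p, g p q) ^ 2 := by
    rw [sum_comm]
    exact sq_sum_le_card_mul_sum_sq (s := univ) (f := fun q => ∑ p, g p q)
  have h2 : ∑ q, (∑ p, g p q) ^ 2 = ∑ c : P × P, ∑ q, g c.1 q * g c.2 q := by
    rw [sum_comm]
    refine sum_congr rfl fun q _ => ?_
    rw [sq, sum_mul_sum, ← sum_product', univ_product_univ]
  have h3 : (∑ c : P × P, ∑ q, g c.1 q * g c.2 q) ^ 2 ≤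
      N ^ 2 * ∑ c : P × P, (∑ q, g c.1 q * g c.2 q) ^ 2 := by
    have := sq_sum_le_card_mul_sum_sq (s := (univ : Finset (P × P)))
      (f := fun c => ∑ q, g c.1 q * g c.2 q)
    rwa [card_univ, Fintype.card_prod, ← hN, ← sq] at this
  have h4 : ∑ c : P × P, (∑ q, g c.1 q * g c.2 q) ^ 2 =
      ∑ p, ∑ p', ∑ q, ∑ q', (g p q * g p' q') * (g p q' * g p' q) := by
    rw [← univ_product_univ, sum_product]
    refine sum_congr rfl fun p _ => sum_congr rfl fun p' _ => ?_
    rw [sq, sum_mul_sum]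
    refine sum_congr rfl fun q _ => sum_congr rfl fun q' _ => by ring
  rw [← h4]
  calc (∑ p, ∑ q, g p q) ^ 4 = ((∑ p, ∑ q, g p q) ^ 2) ^ 2 := by ring
    _ ≤ (N * ∑ c : P × P, ∑ q, g c.1 q * g c.2 q) ^ 2 := by rw [← h2]; gcongr
    _ = N ^ 2 * (∑ c : P × P, ∑ q, g c.1 q * g c.2 q) ^ 2 := by ring
    _ ≤ N ^ 2 * (N ^ 2 * ∑ c : P × P, (∑ q, g c.1 q * g c.2 q) ^ 2) := by gcongr
    _ = _ := by ring

/-- A weighted count of four-cycles: a family of edges `(x ω, y ω)` of a digraph `D` without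
concentration has many pairs which span a four-cycle. -/
lemma pow_four_card_le_sum_four_cycles {Ω P : Type*} [Fintype P] [DecidableEq P]
    (D : P → P → Prop) [DecidableRel D] (S : Finset Ω) (x y : Ω → P)
    (hD : ∀ ω ∈ S, D (x ω) (y ω)) {M : ℕ}
    (hM : ∀ p q, Fintype.card P ^ 2 * (S.filter fun ω => x ω = p ∧ y ω = q).card ≤ M) :
    S.card ^ 4 ≤ M ^ 2 *
      ∑ ω ∈ S, (S.filter fun ω' => D (x ω) (y ω') ∧ D (x ω') (y ω)).card := by
  set N := Fintype.card P with hN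
  set g : P → P → ℕ := fun p q => (S.filter fun ω => x ω = p ∧ y ω = q).card with hg
  have hfib : ∀ F : P → P → ℕ, ∑ p, ∑ q, g p q * F p q = ∑ ω ∈ S, F (x ω) (y ω) := by
    intro F
    rw [← sum_product' (f := fun p q => g p q * F p q), univ_product_univ,
      ← sum_fiberwise S (fun ω => (x ω, y ω))]
    refine sum_congr rfl fun c _ => ?_
    rw [sum_congr rfl (g := fun _ => F c.1 c.2), sum_const, smul_eq_mul]
    · simp [hg, Prod.ext_iff]
    · rintro ω hω
      rw [← (mem_filter.mp hω).2]
  have hgD : ∀ p q, N ^ 2 * g p q ≤ M * if D p q then 1 else 0 := by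
    intro p q
    split_ifs with h
    · simpa using hM p q
    · have : g p q = 0 := by
        rw [hg, card_eq_zero, filter_eq_empty_iff]
        rintro ω hω ⟨rfl, rfl⟩
        exact h (hD ω hω)
      simp [this]
  have hcard : S.card = ∑ p, ∑ q, g p q := by
    have := hfib fun _ _ => 1
    simpa using this.symm
  have hR : ∑ ω ∈ S, (S.filter fun ω' => D (x ω) (y ω') ∧ D (x ω') (y ω)).card =
      ∑ p, ∑ p', ∑ q, ∑ q', (g p q * g p' q') *
        ((if D p q' then 1 else 0) * (if D p' q then 1 else 0)) := by
    have h1 := hfib fun p q => ∑ ω' ∈ S,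
      (if D p (y ω') then 1 else 0) * (if D (x ω') q then 1 else 0)
    have h2 : ∀ p q, ∑ ω' ∈ S, (if D p (y ω') then 1 else 0) * (if D (x ω') q then 1 else 0) =
        ∑ p', ∑ q', g p' q' * ((if D p q' then 1 else 0) * (if D p' q then 1 else 0)) :=
      fun p q => (hfib fun p' q' => (if D p q' then 1 else 0) * (if D p' q then 1 else 0)).symm
    calc _ = ∑ ω ∈ S, ∑ ω' ∈ S,
          (if D (x ω) (y ω') then 1 else 0) * (if D (x ω') (y ω) then 1 else 0) := by
          refine sum_congr rfl fun ω _ => ?_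
          rw [card_filter]
          refine sum_congr rfl fun ω' _ => ?_
          by_cases h : D (x ω) (y ω') <;> by_cases h' : D (x ω') (y ω) <;> simp [h, h']
      _ = _ := h1.symm
      _ = _ := by
          refine sum_congr rfl fun p _ => ?_
          rw [sum_comm]
          refine sum_congr rfl fun q _ => ?_
          rw [h2, mul_sum]
          refine sum_congr rfl fun p' _ => ?_
          rw [mul_sum]
          exact sum_congr rfl fun q' _ => by ring
  rw [hcard, hR]
  refine (sum_pow_four_le_sum_four_cycles g).trans ?_
  simp only [mul_sum]
  refine sum_le_sum fun p _ => sum_le_sum fun p' _ => sum_le_sum fun q _ =>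
    sum_le_sum fun q' _ => ?_
  calc N ^ 4 * (g p q * g p' q' * (g p q' * g p' q)) =
      (g p q * g p' q') * ((N ^ 2 * g p q') * (N ^ 2 * g p' q)) := by ring
    _ ≤ (g p q * g p' q') * ((M * if D p q' then 1 else 0) * (M * if D p' q then 1 else 0)) := by
        exact Nat.mul_le_mul_left _ (Nat.mul_le_mul (hgD _ _) (hgD _ _))
    _ = _ := by ring

lemma card_filter_forall_not {P ι : Type*} [Fintype P] [Fintype ι] [DecidableEq ι]
    {D : P → P → Prop} [DecidableRel D] (p : P) :
    (univ.filter fun ω : ι → P => ∀ i, ¬ D p (ω i)).card =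
      (univ.filter fun q => ¬ D p q).card ^ Fintype.card ι := by
  have h : (univ.filter fun ω : ι → P => ∀ i, ¬ D p (ω i)) =
      Fintype.piFinset fun _ => univ.filter fun q => ¬ D p q := by
    ext ω
    simp [Fintype.mem_piFinset]
  rw [h, Fintype.card_piFinset, prod_const, card_univ]

section Samples

variable {P ι : Type*} [Fintype P] [DecidableEq P] [Fintype ι] [DecidableEq ι]

lemma card_mul_card_filter_apply_eq (i : ι) (p : P) :
    Fintype.card P * (univ.filter fun ω : ι → P => ω i = p).card ≤ Fintype.card (ι → P) := by
  rw [← card_univ (α := P), ← card_product, ← card_univ]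
  refine card_le_card_of_injOn (fun c => Function.update c.2 i c.1) (fun _ _ => mem_univ _) ?_
  rintro ⟨x, ω⟩ hω ⟨x', ω'⟩ hω' h
  simp only [coe_product, Set.mem_prod, mem_coe, mem_filter, mem_univ, true_and] at hω hω' h
  have hx : x = x' := by simpa using congrFun h i
  refine Prod.ext hx (funext fun k => ?_)
  by_cases hk : k = i
  · subst hk; exact hω.trans hω'.symm
  · simpa [hk] using congrFun h k

lemma card_sq_mul_card_filter_apply_eq {i j : ι} (hij : i ≠ j) (p q : P) :
    Fintype.card P ^ 2 * (univ.filter fun ω : ι → P => ω i = p ∧ ω j = q).card ≤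
      Fintype.card (ι → P) := by
  rw [sq, ← Fintype.card_prod, ← card_univ (α := P × P), ← card_product, ← card_univ]
  refine card_le_card_of_injOn
    (fun c => Function.update (Function.update c.2 i c.1.1) j c.1.2) (fun _ _ => mem_univ _) ?_
  rintro ⟨⟨x, y⟩, ω⟩ hω ⟨⟨x', y'⟩, ω'⟩ hω' h
  simp only [coe_product, Set.mem_prod, mem_coe, mem_filter, mem_univ, true_and] at hω hω' h
  have hy : y = y' := by simpa using congrFun h j
  have hx : x = x' := by simpa [hij] using congrFun h i
  refine Prod.ext (Prod.ext hx hy) (funext fun k => ?_)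
  by_cases hk : k = i
  · subst hk; exact hω.1.trans hω'.1.symm
  by_cases hk' : k = j
  · subst hk'; exact hω.2.trans hω'.2.symm
  · simpa [hk, hk'] using congrFun h k

lemma card_mul_card_filter_fiber_le {seg : P → ℕ} {K : ℕ}
    (hK : ∀ m, (univ.filter fun p => seg p = m).card ≤ K) (i : ι) (m : ℕ) :
    Fintype.card P * (univ.filter fun ω : ι → P => seg (ω i) = m).card ≤
      K * Fintype.card (ι → P) := by
  have hsub : (univ.filter fun ω : ι → P => seg (ω i) = m) ⊆
      (univ.filter fun p => seg p = m).biUnion fun p => univ.filter fun ω : ι → P => ω i = p := by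
    intro ω hω
    simpa using hω
  calc _ ≤ Fintype.card P * ∑ p ∈ univ.filter (fun p => seg p = m),
        (univ.filter fun ω : ι → P => ω i = p).card :=
        Nat.mul_le_mul_left _ ((card_le_card hsub).trans card_biUnion_le)
    _ ≤ (univ.filter fun p => seg p = m).card • Fintype.card (ι → P) := by
        rw [mul_sum]
        exact sum_le_card_nsmul _ _ _ fun p _ => card_mul_card_filter_apply_eq i p
    _ ≤ _ := Nat.mul_le_mul_right _ (hK m)

lemma card_mul_card_filter_collision_le {seg : P → ℕ} {K : ℕ}
    (hK : ∀ m, (univ.filter fun p => seg p = m).card ≤ K) {i j : ι} (hij : i ≠ j) :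
    Fintype.card P * (univ.filter fun ω : ι → P => seg (ω i) = seg (ω j)).card ≤
      K * Fintype.card (ι → P) := by
  rcases Nat.eq_zero_or_pos (Fintype.card P) with h0 | h0
  · simp [h0]
  refine Nat.le_of_mul_le_mul_left ?_ h0
  have hsub : (univ.filter fun ω : ι → P => seg (ω i) = seg (ω j)) ⊆
      (univ : Finset P).biUnion fun p => (univ.filter fun q => seg q = seg p).biUnion fun q =>
        univ.filter fun ω : ι → P => ω i = p ∧ ω j = q := by
    intro ω hω
    simp only [mem_filter, mem_univ, true_and, mem_biUnion] at hω ⊢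
    exact ⟨ω i, ω j, hω.symm, rfl, rfl⟩
  calc _ ≤ Fintype.card P ^ 2 * ∑ p : P, ∑ q ∈ univ.filter (fun q => seg q = seg p),
        (univ.filter fun ω : ι → P => ω i = p ∧ ω j = q).card := by
        rw [← mul_assoc, ← sq]
        refine Nat.mul_le_mul_left _ ((card_le_card hsub).trans ?_)
        exact card_biUnion_le.trans (sum_le_sum fun p _ => card_biUnion_le)
    _ ≤ ∑ p : P, ∑ q ∈ univ.filter (fun q => seg q = seg p), Fintype.card (ι → P) := by
        simp only [mul_sum]
        exact sum_le_sum fun p _ => sum_le_sum fun q _ => card_sq_mul_card_filter_apply_eq hij p q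
    _ ≤ ∑ p : P, K * Fintype.card (ι → P) := by
        refine sum_le_sum fun p _ => ?_
        rw [sum_const, smul_eq_mul]
        exact Nat.mul_le_mul_right _ (hK _)
    _ = _ := by rw [sum_const, smul_eq_mul, card_univ]

lemma card_mul_card_filter_not_injective_le {seg : P → ℕ} {K : ℕ}
    (hK : ∀ m, (univ.filter fun p => seg p = m).card ≤ K) :
    Fintype.card P * (univ.filter fun ω : ι → P => ¬ Function.Injective (seg ∘ ω)).card ≤
      Fintype.card ι ^ 2 * (K * Fintype.card (ι → P)) := by
  have hsub : (univ.filter fun ω : ι → P => ¬ Function.Injective (seg ∘ ω)) ⊆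
      (univ : Finset ι).offDiag.biUnion fun c =>
        univ.filter fun ω : ι → P => seg (ω c.1) = seg (ω c.2) := by
    intro ω hω
    simp only [mem_filter, mem_univ, true_and, Function.Injective, not_forall] at hω
    obtain ⟨i, j, h, hij⟩ := hω
    simp only [mem_biUnion, mem_offDiag, mem_univ, true_and, mem_filter]
    exact ⟨(i, j), hij, h⟩
  calc _ ≤ ∑ c ∈ (univ : Finset ι).offDiag, Fintype.card P *
        (univ.filter fun ω : ι → P => seg (ω c.1) = seg (ω c.2)).card := by
        rw [← mul_sum]
        exact Nat.mul_le_mul_left _ ((card_le_card hsub).trans card_biUnion_le)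
    _ ≤ (univ : Finset ι).offDiag.card • (K * Fintype.card (ι → P)) :=
        sum_le_card_nsmul _ _ _ fun c hc =>
          card_mul_card_filter_collision_le hK (mem_offDiag.mp hc).2.2
    _ ≤ _ := by
        rw [smul_eq_mul]
        refine Nat.mul_le_mul_right _ ?_
        rw [offDiag_card, card_univ, sq]
        exact Nat.sub_le _ _

lemma card_mul_card_filter_conflict_le {seg : P → ℕ} {K : ℕ}
    (hK : ∀ m, (univ.filter fun p => seg p = m).card ≤ K) (ω : ι → P) :
    Fintype.card P * (univ.filter fun ω' : ι → P => ∃ i j, seg (ω i) = seg (ω' j)).card ≤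
      Fintype.card ι ^ 2 * (K * Fintype.card (ι → P)) := by
  have hsub : (univ.filter fun ω' : ι → P => ∃ i j, seg (ω i) = seg (ω' j)) ⊆
      (univ : Finset (ι × ι)).biUnion fun c =>
        univ.filter fun ω' : ι → P => seg (ω' c.2) = seg (ω c.1) := by
    intro ω' hω
    simp only [mem_filter, mem_univ, true_and, mem_biUnion, Prod.exists] at hω ⊢
    obtain ⟨i, j, h⟩ := hω
    exact ⟨i, j, h.symm⟩
  calc _ ≤ ∑ c : ι × ι, Fintype.card P *
        (univ.filter fun ω' : ι → P => seg (ω' c.2) = seg (ω c.1)).card := by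
        rw [← mul_sum]
        exact Nat.mul_le_mul_left _ ((card_le_card hsub).trans card_biUnion_le)
    _ ≤ (univ : Finset (ι × ι)).card • (K * Fintype.card (ι → P)) :=
        sum_le_card_nsmul _ _ _ fun c _ => card_mul_card_filter_fiber_le hK _ _
    _ = _ := by rw [smul_eq_mul, card_univ, Fintype.card_prod, sq]

lemma two_mul_card_filter_good {D : P → P → Prop} [DecidableRel D] {seg : P → ℕ} {K Δ : ℕ}
    (hK : ∀ m, (univ.filter fun p => seg p = m).card ≤ K)
    (hΔ : ∀ p, Fintype.card P ≤ Δ * (univ.filter (D p)).card) (hP : 0 < Fintype.card P)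
    (h1 : 4 * Fintype.card ι ^ 2 * K ≤ Fintype.card P)
    (h2 : 4 * Fintype.card P * (Δ - 1) ^ Fintype.card ι ≤ Δ ^ Fintype.card ι) :
    Fintype.card (ι → P) ≤ 2 * (univ.filter fun ω : ι → P =>
      Function.Injective (seg ∘ ω) ∧ ∀ p, ∃ i, D p (ω i)).card := by
  set N := Fintype.card P with hN
  set W := Fintype.card (ι → P) with hW
  have hΔ0 : 0 < Δ := by
    obtain ⟨p⟩ := Fintype.card_pos_iff.mp hP
    refine Nat.pos_of_ne_zero fun h => ?_
    have := hΔ p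
    rw [h] at this
    omega
  set S₁ := univ.filter fun ω : ι → P => ¬ Function.Injective (seg ∘ ω)
  set S₂ := (univ : Finset P).biUnion fun p => univ.filter fun ω : ι → P => ∀ i, ¬ D p (ω i)
  have hS₁ : 4 * S₁.card ≤ W := by
    refine Nat.le_of_mul_le_mul_left ?_ hP
    have := card_mul_card_filter_not_injective_le (ι := ι) hK
    calc N * (4 * S₁.card) = 4 * (N * S₁.card) := by ring
      _ ≤ 4 * (Fintype.card ι ^ 2 * (K * W)) := Nat.mul_le_mul_left _ this
      _ = (4 * Fintype.card ι ^ 2 * K) * W := by ring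
      _ ≤ N * W := Nat.mul_le_mul_right _ h1
  have hS₂ : 4 * S₂.card ≤ W := by
    have hp : ∀ p, Δ * (univ.filter fun q => ¬ D p q).card ≤ (Δ - 1) * N := by
      intro p
      have h3 : (univ.filter (D p)).card + (univ.filter fun q => ¬ D p q).card = N := by
        rw [card_filter_add_card_filter_not, card_univ]
      have h4 := hΔ p
      obtain ⟨e, rfl⟩ : ∃ e, Δ = e + 1 := ⟨Δ - 1, by omega⟩
      rw [Nat.add_sub_cancel]
      nlinarith
    have hp' : ∀ p, Δ ^ Fintype.card ι * (univ.filter fun ω : ι → P => ∀ i, ¬ D p (ω i)).card ≤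
        (Δ - 1) ^ Fintype.card ι * W := by
      intro p
      rw [card_filter_forall_not, ← mul_pow, hW, Fintype.card_fun, ← mul_pow]
      exact Nat.pow_le_pow_left (hp p) _
    refine Nat.le_of_mul_le_mul_left ?_ (pow_pos hΔ0 (Fintype.card ι))
    calc Δ ^ Fintype.card ι * (4 * S₂.card)
        ≤ Δ ^ Fintype.card ι * (4 * ∑ p : P,
          (univ.filter fun ω : ι → P => ∀ i, ¬ D p (ω i)).card) := by
          gcongr
          exact card_biUnion_le
      _ = 4 * ∑ p : P, Δ ^ Fintype.card ι *
          (univ.filter fun ω : ι → P => ∀ i, ¬ D p (ω i)).card := by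
          rw [← mul_sum]; ring
      _ ≤ 4 * ∑ p : P, (Δ - 1) ^ Fintype.card ι * W := by
          exact Nat.mul_le_mul_left _ (sum_le_sum fun p _ => hp' p)
      _ = (4 * N * (Δ - 1) ^ Fintype.card ι) * W := by
          rw [sum_const, card_univ, smul_eq_mul]; ring
      _ ≤ _ := Nat.mul_le_mul_right _ h2
  have hsub : (univ : Finset (ι → P)) ⊆ (univ.filter fun ω : ι → P =>
      Function.Injective (seg ∘ ω) ∧ ∀ p, ∃ i, D p (ω i)) ∪ (S₁ ∪ S₂) := by
    intro ω _
    simp only [S₁, S₂, mem_union, mem_filter, mem_univ, true_and, mem_biUnion]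
    by_cases ha : Function.Injective (seg ∘ ω)
    · by_cases hb : ∀ p, ∃ i, D p (ω i)
      · exact Or.inl ⟨ha, hb⟩
      · push Not at hb
        exact Or.inr (Or.inr hb)
    · exact Or.inr (Or.inl ha)
  have h5 := (card_le_card hsub).trans (card_union_le _ _)
  have h6 := card_union_le S₁ S₂
  rw [card_univ] at h5
  omega

end Samples

lemma exists_mem_periodicPts {P : Type*} [Finite P] [Nonempty P] (f : P → P) :
    (Function.periodicPts f).Nonempty := by
  obtain ⟨p⟩ := ‹Nonempty P›
  obtain ⟨m, k, hne, h⟩ := Finite.exists_ne_map_eq_of_infinite fun n : ℕ => f^[n] p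
  wlog hmk : m < k generalizing m k
  · exact this k m hne.symm h.symm (by omega)
  refine ⟨f^[m] p, Function.mk_mem_periodicPts (n := k - m) (by omega) ?_⟩
  rw [Function.IsPeriodicPt, Function.IsFixedPt, ← Function.iterate_add_apply,
    Nat.sub_add_cancel hmk.le, h]

/-- In a dense digraph, there is a disjoint union of cycles, visiting every class of `seg` at most
once, whose arcs span many four-cycles. -/
theorem exists_bijOn_of_outdegree {P : Type*} [Fintype P] [DecidableEq P] (D : P → P → Prop)
    [DecidableRel D] (hirr : ∀ p, ¬ D p p) (seg : P → ℕ) {K Δ s T : ℕ}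
    (hK : ∀ m, (univ.filter fun p => seg p = m).card ≤ K)
    (hΔ : ∀ p, Fintype.card P ≤ Δ * (univ.filter (D p)).card) (hs : 0 < s) (hT : 0 < T)
    (h1 : 4 * s ^ 2 * K ≤ Fintype.card P)
    (h2 : 4 * Fintype.card P * (Δ - 1) ^ s ≤ Δ ^ s)
    (h3 : 128 * T * s ^ 6 * K < Fintype.card P) :
    ∃ (Z : Finset P) (f : P → P), Set.BijOn f Z Z ∧ Set.InjOn seg (Z : Set P) ∧
      (∀ p ∈ Z, D p (f p)) ∧ T ^ 2 ≤ 64 * s ^ 4 * ((Z ×ˢ Z).filter fun c =>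
        c.1 ≠ c.2 ∧ D c.1 (f c.2) ∧ D c.2 (f c.1)).card := by
  classical
  set N := Fintype.card P with hN
  have hN0 : 0 < N := (Nat.zero_le _).trans_lt h3
  have : Nonempty P := Fintype.card_pos_iff.mp hN0
  set W := Fintype.card (Fin s → P) with hW
  have hW0 : 0 < W := Fintype.card_pos
  set S := univ.filter fun ω : Fin s → P =>
    Function.Injective (seg ∘ ω) ∧ ∀ p, ∃ i, D p (ω i) with hS
  have hSW : W ≤ 2 * S.card := by
    have h := two_mul_card_filter_good (ι := Fin s) hK hΔ hN0 (by rwa [Fintype.card_fin])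
      (by rwa [Fintype.card_fin])
    convert h
  have hφ : ∀ ω : Fin s → P, ∃ φ : P → P, ω ∈ S → ∀ p, D p (φ p) ∧ φ p ∈ Set.range ω := by
    intro ω
    by_cases hω : ω ∈ S
    · choose i hi using (mem_filter.mp hω).2.2
      exact ⟨fun p => ω (i p), fun _ p => ⟨hi p, i p, rfl⟩⟩
    · exact ⟨id, fun h => absurd h hω⟩
  choose φ hφ using hφ
  choose x hx using fun ω => exists_mem_periodicPts (φ ω)
  have hxmem : ∀ ω ∈ S, x ω ∈ Set.range ω := by
    intro ω hω
    obtain ⟨p, hp⟩ := Function.periodicPts_subset_range (hx ω)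
    rw [← hp]
    exact (hφ ω hω p).2
  have hDxy : ∀ ω ∈ S, D (x ω) (φ ω (x ω)) := fun ω hω => (hφ ω hω _).1
  have hM : ∀ p q, N ^ 2 * (S.filter fun ω => x ω = p ∧ φ ω (x ω) = q).card ≤ s ^ 2 * W := by
    intro p q
    have hsub : (S.filter fun ω => x ω = p ∧ φ ω (x ω) = q) ⊆
        (univ : Finset (Fin s)).offDiag.biUnion fun c =>
          univ.filter fun ω : Fin s → P => ω c.1 = p ∧ ω c.2 = q := by
      intro ω hω
      obtain ⟨hωS, hp, hq⟩ := mem_filter.mp hω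
      obtain ⟨i, hi⟩ := hxmem ω hωS
      obtain ⟨j, hj⟩ := (hφ ω hωS (x ω)).2
      have hij : i ≠ j := by
        rintro rfl
        have := hDxy ω hωS
        rw [← hj, ← hi] at this
        exact hirr _ this
      simp only [mem_biUnion, mem_offDiag, mem_univ, true_and, mem_filter]
      exact ⟨(i, j), hij, hi.trans hp, hj.trans hq⟩
    calc _ ≤ ∑ c ∈ (univ : Finset (Fin s)).offDiag, N ^ 2 *
          (univ.filter fun ω : Fin s → P => ω c.1 = p ∧ ω c.2 = q).card := by
          rw [← mul_sum]
          exact Nat.mul_le_mul_left _ ((card_le_card hsub).trans card_biUnion_le)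
      _ ≤ (univ : Finset (Fin s)).offDiag.card • W :=
          sum_le_card_nsmul _ _ _ fun c hc =>
            card_sq_mul_card_filter_apply_eq (mem_offDiag.mp hc).2.2 p q
      _ ≤ _ := by
          rw [smul_eq_mul, offDiag_card, card_univ, Fintype.card_fin, sq]
          exact Nat.mul_le_mul_right _ (Nat.sub_le _ _)
  let R : (Fin s → P) → (Fin s → P) → Prop :=
    fun ω ω' => D (x ω) (φ ω' (x ω')) ∧ D (x ω') (φ ω (x ω))
  let C : (Fin s → P) → (Fin s → P) → Prop := fun ω ω' => ∃ i j, seg (ω i) = seg (ω' j)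
  have hR : W ^ 2 ≤ 16 * s ^ 4 * ∑ ω ∈ S, (S.filter (R ω)).card := by
    have h := pow_four_card_le_sum_four_cycles D S x (fun ω => φ ω (x ω)) hDxy hM
    have h' : W ^ 4 ≤ 16 * S.card ^ 4 := by
      calc W ^ 4 ≤ (2 * S.card) ^ 4 := Nat.pow_le_pow_left hSW 4
        _ = _ := by ring
    refine Nat.le_of_mul_le_mul_left ?_ (pow_pos hW0 2)
    calc W ^ 2 * W ^ 2 = W ^ 4 := by ring
      _ ≤ 16 * S.card ^ 4 := h'
      _ ≤ 16 * ((s ^ 2 * W) ^ 2 * ∑ ω ∈ S, (S.filter (R ω)).card) := Nat.mul_le_mul_left _ h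
      _ = _ := by ring
  set d := s ^ 2 * (K * W) / N with hd
  have hdN : N * d ≤ s ^ 2 * (K * W) := Nat.mul_div_le _ _
  obtain ⟨I, J, hIS, hJS, hpair, hdisj, hIJ⟩ := exists_dense_pair_of_card (K := C) (R := R)
    (fun ω => ⟨⟨0, hs⟩, ⟨0, hs⟩, rfl⟩) (fun ω ω' ⟨i, j, h⟩ => ⟨j, i, h.symm⟩) (d := d)
    (B := 16 * s ^ 4) (T := T) (fun ω => by
      rw [hd, Nat.le_div_iff_mul_le hN0, mul_comm]
      have := card_mul_card_filter_conflict_le hK ω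
      rw [Fintype.card_fin] at this
      convert this) S hR hT (by
      refine Nat.lt_of_mul_lt_mul_left (a := N) ?_
      calc N * (8 * (16 * s ^ 4) * T * d) = 8 * (16 * s ^ 4) * T * (N * d) := by ring
        _ ≤ 8 * (16 * s ^ 4) * T * (s ^ 2 * (K * W)) := Nat.mul_le_mul_left _ hdN
        _ = (128 * T * s ^ 6 * K) * W := by ring
        _ < N * W := Nat.mul_lt_mul_of_pos_right h3 hW0)
  have hIJS : I ∪ J ⊆ S := union_subset hIS hJS
  have huniq : ∀ ω ∈ I ∪ J, ∀ ω' ∈ I ∪ J, ∀ i j, seg (ω i) = seg (ω' j) → ω = ω' := by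
    intro ω hω ω' hω' i j h
    by_contra hne
    exact hpair hω hω' hne ⟨i, j, h⟩
  set U : Set P := {p | ∃ ω ∈ I ∪ J, p ∈ Set.range ω} with hU
  let f : P → P := fun p => if h : ∃ ω ∈ I ∪ J, p ∈ Set.range ω then φ h.choose p else p
  have hf : ∀ ω ∈ I ∪ J, ∀ p ∈ Set.range ω, f p = φ ω p := by
    intro ω hω p hp
    have h : ∃ ω ∈ I ∪ J, p ∈ Set.range ω := ⟨ω, hω, hp⟩
    have hfp : f p = φ h.choose p := dif_pos h
    obtain ⟨hω', hp'⟩ := h.choose_spec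
    rw [hfp]
    obtain ⟨i, hi⟩ := hp
    obtain ⟨j, hj⟩ := hp'
    rw [huniq _ hω' _ hω j i (by rw [hi, hj])]
  have hfU : ∀ p ∈ U, f p ∈ U := by
    rintro p ⟨ω, hω, hp⟩
    refine ⟨ω, hω, ?_⟩
    rw [hf ω hω p hp]
    exact (hφ ω (hIJS hω) p).2
  have hfiter : ∀ n : ℕ, ∀ p ∈ U, f^[n] p ∈ U := by
    intro n
    induction n with
    | zero => exact fun p hp => hp
    | succ n ih => exact fun p hp => ih _ (hfU p hp)
  have hxper : ∀ ω ∈ I ∪ J, x ω ∈ Function.periodicPts f := by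
    intro ω hω
    obtain ⟨n, hn, hper⟩ := hx ω
    refine ⟨n, hn, ?_⟩
    have : ∀ m : ℕ, f^[m] (x ω) = (φ ω)^[m] (x ω) ∧ f^[m] (x ω) ∈ Set.range ω := by
      intro m
      induction m with
      | zero => exact ⟨rfl, hxmem ω (hIJS hω)⟩
      | succ m ih =>
        rw [Function.iterate_succ_apply', Function.iterate_succ_apply', ← ih.1,
          hf ω hω _ ih.2]
        exact ⟨rfl, (hφ ω (hIJS hω) _).2⟩
    exact (this n).1.trans hper
  have hxU : ∀ ω ∈ I ∪ J, x ω ∈ U := fun ω hω => ⟨ω, hω, hxmem ω (hIJS hω)⟩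
  have hxinj : ∀ ω ∈ I ∪ J, ∀ ω' ∈ I ∪ J, x ω = x ω' → ω = ω' := by
    intro ω hω ω' hω' h
    obtain ⟨i, hi⟩ := hxmem ω (hIJS hω)
    obtain ⟨j, hj⟩ := hxmem ω' (hIJS hω')
    exact huniq ω hω ω' hω' i j (by rw [hi, hj, h])
  have hfx : ∀ ω ∈ I ∪ J, f (x ω) = φ ω (x ω) := fun ω hω => hf ω hω _ (hxmem ω (hIJS hω))
  set Z : Finset P := univ.filter fun p => p ∈ U ∧ p ∈ Function.periodicPts f with hZ
  have hZmem : ∀ p, p ∈ Z ↔ p ∈ U ∧ p ∈ Function.periodicPts f := by simp [hZ]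
  have hbij := Function.bijOn_periodicPts f
  refine ⟨Z, f, ⟨fun p hp => ?_, fun p hp q hq h => ?_, fun p hp => ?_⟩, fun p hp q hq h => ?_,
    fun p hp => ?_, ?_⟩
  · rw [mem_coe, hZmem] at hp ⊢
    exact ⟨hfU p hp.1, hbij.mapsTo hp.2⟩
  · rw [mem_coe, hZmem] at hp hq
    exact hbij.injOn hp.2 hq.2 h
  · rw [mem_coe, hZmem] at hp
    obtain ⟨n, hn, hper⟩ := hp.2
    obtain ⟨m, rfl⟩ : ∃ m, n = m + 1 := ⟨n - 1, by omega⟩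
    refine ⟨f^[m] p, ?_, ?_⟩
    · rw [mem_coe, hZmem]
      exact ⟨hfiter m p hp.1, m + 1, hn, hper.apply_iterate m⟩
    · exact (Function.iterate_succ_apply' f m p).symm.trans hper
  · rw [mem_coe, hZmem] at hp hq
    obtain ⟨ω, hω, i, rfl⟩ := hp.1
    obtain ⟨ω', hω', j, rfl⟩ := hq.1
    obtain rfl := huniq ω hω ω' hω' i j h
    rw [(mem_filter.mp (hIJS hω)).2.1 h]
  · rw [hZmem] at hp
    obtain ⟨ω, hω, hpω⟩ := hp.1
    rw [hf ω hω p hpω]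
    exact (hφ ω (hIJS hω) p).1
  · have hcount : ∑ ω ∈ J, (I.filter fun ω' => R ω' ω).card ≤ ((Z ×ˢ Z).filter fun c =>
        c.1 ≠ c.2 ∧ D c.1 (f c.2) ∧ D c.2 (f c.1)).card := by
      rw [← card_sigma]
      refine card_le_card_of_injOn (fun c => (x c.2, x c.1)) ?_ ?_
      · rintro ⟨ω, ω'⟩ hc
        simp only [coe_sigma, Set.mem_sigma_iff, mem_coe, mem_filter] at hc
        obtain ⟨hωJ, hωI, hRω⟩ := hc
        have hω := mem_union_right I hωJ
        have hω' := mem_union_left J hωI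
        simp only [coe_filter, mem_product, hZmem, Set.mem_ofPred_eq]
        refine ⟨⟨⟨hxU _ hω', hxper _ hω'⟩, hxU _ hω, hxper _ hω⟩, fun h => ?_, ?_, ?_⟩
        · have := hxinj _ hω' _ hω h
          subst this
          exact disjoint_left.mp hdisj hωI hωJ
        · rw [hfx _ hω]; exact hRω.1
        · rw [hfx _ hω']; exact hRω.2
      · rintro ⟨ω₁, ω₁'⟩ h₁ ⟨ω₂, ω₂'⟩ h₂ h
        simp only [coe_sigma, Set.mem_sigma_iff, mem_coe, mem_filter] at h₁ h₂
        simp only [Prod.mk.injEq] at h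
        obtain rfl := hxinj _ (mem_union_left J h₁.2.1) _ (mem_union_left J h₂.2.1) h.1
        obtain rfl := hxinj _ (mem_union_right I h₁.1) _ (mem_union_right I h₂.1) h.2
        rfl
    calc T ^ 2 ≤ 4 * (16 * s ^ 4) * ∑ ω ∈ J, (I.filter fun ω' => R ω' ω).card := hIJ
      _ ≤ 4 * (16 * s ^ 4) * _ := Nat.mul_le_mul_left _ hcount
      _ = _ := by ring

/-- Among sufficiently many dense sets, two have a dense intersection. -/
lemma exists_dense_inter {V ι : Type*} [Fintype V] [DecidableEq V] [DecidableEq ι] {A : ℕ}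
    (hA : 0 < A) (hV : 0 < Fintype.card V) (Nb : ι → Finset V) (X : Finset ι)
    (hNb : ∀ i ∈ X, Fintype.card V ≤ A * (Nb i).card) (hX : 2 * A ^ 2 < X.card) :
    ∃ i ∈ X, ∃ j ∈ X, i ≠ j ∧ Fintype.card V ≤ 2 * A ^ 2 * (Nb i ∩ Nb j).card := by
  by_contra! hcon
  set n := Fintype.card V with hn
  set S := ∑ i ∈ X, (Nb i).card with hS
  have hS1 : X.card * n ≤ A * S := by
    rw [hS, mul_sum, ← smul_eq_mul]
    exact card_nsmul_le_sum _ _ _ hNb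
  have hdeg : ∑ v, ∑ i ∈ X, (if v ∈ Nb i then 1 else 0) = S := by
    rw [sum_comm, hS]
    exact sum_congr rfl fun i _ => by simp
  have hcs : S ^ 2 ≤ n * ∑ v, (∑ i ∈ X, (if v ∈ Nb i then 1 else 0)) ^ 2 := by
    rw [← hdeg]
    exact sq_sum_le_card_mul_sum_sq (s := univ)
      (f := fun v => ∑ i ∈ X, (if v ∈ Nb i then 1 else 0))
  have hsq : ∑ v, (∑ i ∈ X, (if v ∈ Nb i then 1 else 0)) ^ 2 =
      ∑ i ∈ X, ∑ j ∈ X, (Nb i ∩ Nb j).card := by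
    simp only [sq, sum_mul_sum]
    rw [sum_comm]
    refine sum_congr rfl fun i _ => ?_
    rw [sum_comm]
    refine sum_congr rfl fun j _ => ?_
    rw [← filter_univ_mem (Nb i ∩ Nb j), card_filter]
    refine sum_congr rfl fun v _ => ?_
    by_cases hi : v ∈ Nb i <;> by_cases hj : v ∈ Nb j <;> simp [hi, hj]
  have hoff : 2 * A ^ 2 * ∑ i ∈ X, ∑ j ∈ X, (Nb i ∩ Nb j).card ≤
      2 * A ^ 2 * S + X.card ^ 2 * n := by
    have hterm : ∀ i ∈ X, ∀ j ∈ X, 2 * A ^ 2 * (Nb i ∩ Nb j).card ≤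
        (if i = j then 2 * A ^ 2 * (Nb i).card else 0) + n := by
      intro i hi j hj
      split_ifs with h
      · subst h
        rw [inter_self]
        omega
      · have := (hcon i hi j hj h).le
        omega
    calc _ = ∑ i ∈ X, ∑ j ∈ X, 2 * A ^ 2 * (Nb i ∩ Nb j).card := by
          rw [mul_sum]
          exact sum_congr rfl fun i _ => mul_sum _ _ _
      _ ≤ ∑ i ∈ X, ∑ j ∈ X, ((if i = j then 2 * A ^ 2 * (Nb i).card else 0) + n) :=
          sum_le_sum fun i hi => sum_le_sum fun j hj => hterm i hi j hj
      _ = _ := by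
          have hrow : ∀ i ∈ X, ∑ j ∈ X, ((if i = j then 2 * A ^ 2 * (Nb i).card else 0) + n) =
              2 * A ^ 2 * (Nb i).card + X.card * n := by
            intro i hi
            rw [sum_add_distrib, sum_ite_eq, if_pos hi, sum_const, smul_eq_mul]
          rw [sum_congr rfl hrow, sum_add_distrib, ← mul_sum, sum_const, smul_eq_mul, sq X.card,
            mul_assoc X.card]
  have h1 : 2 * A ^ 2 * S ^ 2 ≤ n * (2 * A ^ 2 * S + X.card ^ 2 * n) := by
    calc 2 * A ^ 2 * S ^ 2 ≤ 2 * A ^ 2 * (n * ∑ i ∈ X, ∑ j ∈ X, (Nb i ∩ Nb j).card) := by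
          rw [← hsq]; exact Nat.mul_le_mul_left _ hcs
      _ = n * (2 * A ^ 2 * ∑ i ∈ X, ∑ j ∈ X, (Nb i ∩ Nb j).card) := by ring
      _ ≤ _ := Nat.mul_le_mul_left _ hoff
  have h2 : (X.card * n) ^ 2 ≤ (A * S) ^ 2 := Nat.pow_le_pow_left hS1 2
  have hA2 : 0 < A ^ 2 := pow_pos hA 2
  have h3 : A ^ 2 * S * S ≤ A ^ 2 * S * (2 * n) := by
    have e1 : n * (2 * A ^ 2 * S + X.card ^ 2 * n) = A ^ 2 * S * (2 * n) + (X.card * n) ^ 2 := by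
      ring
    have e2 : (A * S) ^ 2 = A ^ 2 * S * S := by ring
    have e3 : 2 * A ^ 2 * S ^ 2 = 2 * (A ^ 2 * S * S) := by ring
    omega
  have hS0 : 0 < S := by
    refine Nat.pos_of_ne_zero fun h => ?_
    rw [h, mul_zero] at hS1
    have : 0 < X.card * n := Nat.mul_pos (by omega) hV
    omega
  have h4 : S ≤ 2 * n := Nat.le_of_mul_le_mul_left h3 (Nat.mul_pos hA2 hS0)
  have h5 : X.card ≤ A * 2 := by
    refine Nat.le_of_mul_le_mul_right (hS1.trans ?_) hV
    rw [mul_assoc]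
    exact Nat.mul_le_mul_left _ h4
  have h6 : A * 1 ≤ A * A := Nat.mul_le_mul_left _ hA
  rw [sq] at hX
  omega

/-- Among the pairs of elements of a dense set `I` which lie in the same segment of length `A ^ 8`,
there are many for which the associated sets have a dense intersection. -/
lemma le_mul_card_dense_pairs {V : Type*} [Fintype V] [DecidableEq V] {A : ℕ} (hA : 3 ≤ A)
    (hV : 32 * A ^ 4 ≤ Fintype.card V) (Nb : ℕ → Finset V)
    (hNb : ∀ i, Fintype.card V ≤ A * (Nb i).card) (I : Finset ℕ)
    (hI : I ⊆ range (Fintype.card V)) (hIc : Fintype.card V ≤ 4 * A ^ 2 * I.card) :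
    Fintype.card V ≤ 8 * A ^ 10 * ((I ×ˢ I).filter fun c => c.1 < c.2 ∧
      c.1 / A ^ 8 = c.2 / A ^ 8 ∧ Fintype.card V ≤ 2 * A ^ 2 * (Nb c.1 ∩ Nb c.2).card).card := by
  set n := Fintype.card V with hn
  set Q := (I ×ˢ I).filter fun c => c.1 < c.2 ∧
      c.1 / A ^ 8 = c.2 / A ^ 8 ∧ n ≤ 2 * A ^ 2 * (Nb c.1 ∩ Nb c.2).card with hQ
  have hA8 : 0 < A ^ 8 := by positivity
  have hn0 : 0 < n := lt_of_lt_of_le (by positivity) hV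
  set F : ℕ → Finset ℕ := fun m => I.filter fun i => i / A ^ 8 = m with hF
  set B := (range (n / A ^ 8 + 1)).filter fun m => 2 * A ^ 2 < (F m).card with hB
  have hFle : ∀ m, (F m).card ≤ A ^ 8 := by
    intro m
    rw [← card_range (A ^ 8)]
    refine card_le_card_of_injOn (fun i => i % A ^ 8) (fun i _ => ?_) fun i hi j hj h => ?_
    · simpa using Nat.mod_lt _ hA8
    · rw [mem_coe, hF, mem_filter] at hi hj
      rw [← Nat.div_add_mod i (A ^ 8), ← Nat.div_add_mod j (A ^ 8), hi.2, hj.2]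
      simp only at h
      rw [h]
  have hBQ : B.card ≤ Q.card := by
    have : ∀ m ∈ B, ∃ c ∈ Q, c.1 / A ^ 8 = m := by
      intro m hm
      obtain ⟨i, hi, j, hj, hij, hd⟩ := exists_dense_inter (A := A) (by omega) hn0 Nb (F m)
        (fun i _ => hNb i) (mem_filter.mp hm).2
      rw [hF, mem_filter] at hi hj
      rcases lt_or_gt_of_ne hij with h | h
      · exact ⟨(i, j), mem_filter.mpr ⟨mem_product.mpr ⟨hi.1, hj.1⟩, h, hi.2.trans hj.2.symm, hd⟩,
          hi.2⟩
      · exact ⟨(j, i), mem_filter.mpr ⟨mem_product.mpr ⟨hj.1, hi.1⟩, h, hj.2.trans hi.2.symm,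
          by rw [inter_comm]; exact hd⟩, hj.2⟩
    refine (card_le_card (t := Q.image fun c => c.1 / A ^ 8) fun m hm => ?_).trans card_image_le
    obtain ⟨c, hc, hcm⟩ := this m hm
    exact mem_image.mpr ⟨c, hc, hcm⟩
  have hsum : I.card ≤ B.card * A ^ 8 + (n / A ^ 8 + 1) * (2 * A ^ 2) := by
    have h1 : I.card = ∑ m ∈ range (n / A ^ 8 + 1), (F m).card := by
      refine card_eq_sum_card_fiberwise fun i hi => ?_
      have := mem_range.mp (hI hi)
      rw [mem_coe, mem_range]
      exact Nat.lt_succ_of_le (Nat.div_le_div_right this.le)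
    rw [h1, ← sum_filter_add_sum_filter_not _ fun m => 2 * A ^ 2 < (F m).card]
    refine Nat.add_le_add ?_ ?_
    · rw [← smul_eq_mul]
      exact sum_le_card_nsmul _ _ _ fun m _ => hFle m
    · refine (sum_le_card_nsmul _ _ (2 * A ^ 2) fun m hm => ?_).trans ?_
      · exact not_lt.mp (mem_filter.mp hm).2
      · rw [smul_eq_mul]
        refine Nat.mul_le_mul_right _ ((card_filter_le _ _).trans ?_)
        rw [card_range]
  have hdiv : A ^ 8 * (n / A ^ 8) ≤ n := Nat.mul_div_le _ _
  have hsmall : 16 * A ^ 4 * (n / A ^ 8 + 1) ≤ n := by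
    have h81 : 81 ≤ A ^ 4 := by
      calc 81 = 3 ^ 4 := by norm_num
        _ ≤ A ^ 4 := Nat.pow_le_pow_left hA 4
    have h32 : 32 * A ^ 4 * (n / A ^ 8) ≤ A ^ 8 * (n / A ^ 8) := by
      refine Nat.mul_le_mul_right _ ?_
      nlinarith [show A ^ 8 = A ^ 4 * A ^ 4 by ring]
    nlinarith
  have h4 : n ≤ 4 * A ^ 2 * (Q.card * A ^ 8 + (n / A ^ 8 + 1) * (2 * A ^ 2)) := by
    refine hIc.trans (Nat.mul_le_mul_left _ (hsum.trans ?_))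
    gcongr
  have h5 : 4 * A ^ 2 * (Q.card * A ^ 8 + (n / A ^ 8 + 1) * (2 * A ^ 2)) =
      4 * A ^ 10 * Q.card + 8 * A ^ 4 * (n / A ^ 8 + 1) := by ring
  nlinarith

/-- The indices near the end of a segment or of the whole interval, and those of a small forbidden
set, are few. -/
lemma card_filter_bad_index_le {n L : ℕ} (hL : 0 < L) (bad : ℕ → Prop) [DecidablePred bad] :
    ((range n).filter fun i => ¬ (i % L + 2 < L ∧ i + 2 < n ∧ ¬ bad i)).card ≤
      2 * (n / L + 1) + 2 + ((range n).filter bad).card := by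
  have hsub : ((range n).filter fun i => ¬ (i % L + 2 < L ∧ i + 2 < n ∧ ¬ bad i)) ⊆
      ((range n).filter fun i => L ≤ i % L + 2) ∪ ((range n).filter fun i => n ≤ i + 2) ∪
        (range n).filter bad := by
    intro i hi
    simp only [mem_filter, mem_union] at hi ⊢
    by_cases h1 : L ≤ i % L + 2
    · exact Or.inl (Or.inl ⟨hi.1, h1⟩)
    by_cases h2 : n ≤ i + 2
    · exact Or.inl (Or.inr ⟨hi.1, h2⟩)
    by_cases h3 : bad i
    · exact Or.inr ⟨hi.1, h3⟩
    · exact absurd ⟨not_le.mp h1, not_le.mp h2, h3⟩ hi.2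
  have h1 : ((range n).filter fun i => L ≤ i % L + 2).card ≤ 2 * (n / L + 1) := by
    have hbox : 2 * (n / L + 1) = (range (n / L + 1) ×ˢ range 2).card := by simp [mul_comm]
    rw [hbox]
    refine card_le_card_of_injOn (fun i => (i / L, L - 1 - i % L)) (fun i hi => ?_)
      fun i hi j hj h => ?_
    · simp only [coe_filter, mem_range, Set.mem_ofPred_eq] at hi
      simp only [coe_product, coe_range, Set.mem_prod, Set.mem_Iio]
      exact ⟨Nat.lt_succ_of_le (Nat.div_le_div_right hi.1.le), by omega⟩
    · simp only [Prod.mk.injEq] at h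
      have hi' := Nat.mod_lt i hL
      have hj' := Nat.mod_lt j hL
      rw [← Nat.div_add_mod i L, ← Nat.div_add_mod j L, h.1]
      omega
  have h2 : ((range n).filter fun i => n ≤ i + 2).card ≤ 2 := by
    have : ((range n).filter fun i => n ≤ i + 2) ⊆ Ico (n - 2) n := by
      intro i hi
      simp only [mem_filter, mem_range, mem_Ico] at hi ⊢
      omega
    refine (card_le_card this).trans ?_
    rw [Nat.card_Ico]
    omega
  refine (card_le_card hsub).trans ((card_union_le _ _).trans ?_)
  have := card_union_le ((range n).filter fun i => L ≤ i % L + 2)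
    ((range n).filter fun i => n ≤ i + 2)
  omega

lemma Finset.card_le_two_mul_ncard_of_injOn {α β : Type*} [Finite β]
    (Z : Finset α) (Q : Finset (α × α)) (hQ : Q ⊆ Z ×ˢ Z) (g : α → β) (hg : Set.InjOn g (Z : Set α))
    (X : Set (Sym2 β)) (hX : ∀ c ∈ Q, s(g c.1, g c.2) ∈ X) : Q.card ≤ 2 * X.ncard := by
  classical
  have h1 : Q.card ≤ 2 * (Q.image fun c => s(g c.1, g c.2)).card := by
    refine card_le_mul_card_image _ _ fun q hq => ?_
    obtain ⟨⟨a, b⟩, hab, rfl⟩ := mem_image.mp hq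
    have hab' := mem_product.mp (hQ hab)
    refine (card_le_card (t := {(a, b), (b, a)}) ?_).trans card_le_two
    rintro ⟨a', b'⟩ h
    rw [mem_filter] at h
    have hab'' := mem_product.mp (hQ h.1)
    rcases Sym2.eq_iff.mp h.2 with ⟨h2, h3⟩ | ⟨h2, h3⟩
    · have h4 : a' = a := hg hab''.1 hab'.1 h2
      have h5 : b' = b := hg hab''.2 hab'.2 h3
      simp [h4, h5]
    · have h4 : a' = b := hg hab''.1 hab'.2 h2
      have h5 : b' = a := hg hab''.2 hab'.1 h3
      simp [h4, h5]
  refine h1.trans (Nat.mul_le_mul_left _ ?_)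
  rw [← Set.ncard_coe_finset]
  refine Set.ncard_le_ncard (fun q hq => ?_) X.toFinite
  obtain ⟨c, hc, rfl⟩ := mem_image.mp (mem_coe.mp hq)
  exact hX c hc

/-- Rerouting a Hamilton cycle along a disjoint union of cycles in an auxiliary digraph, whose
vertices are pairs of edges of the Hamilton cycle. -/
theorem exists_isHamCycleOn_of_bijOn {V P : Type*} [Fintype V] {G C : SimpleGraph V}
    (hCG : C ≤ G) {τ : Equiv.Perm V} (hτ : ∀ u v, τ.SameCycle u v) (hcard : 3 ≤ Fintype.card V)
    (hCτ : ∀ u v, C.Adj u v ↔ τ u = v ∨ τ v = u) (u : ℕ → V) (hu : ∀ k, τ (u k) = u (k + 1))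
    (huinj : ∀ i < Fintype.card V, ∀ j < Fintype.card V, u i = u j → i = j)
    (E₀ : Set (Sym2 V)) (hE₀ : E₀ ⊆ C.edgeSet) {L : ℕ} (idx : P → Bool → ℕ) (seg : P → ℕ)
    (hlt : ∀ p, idx p false < idx p true) (hseg : ∀ p c, idx p c / L = seg p)
    (hend : ∀ p c, idx p c % L + 2 < L) (hn : ∀ p c, idx p c + 2 < Fintype.card V)
    (hidx : ∀ p c, s(u (idx p c), u (idx p c + 1)) ∉ E₀) (D : P → P → Prop)
    (hD : ∀ p q, D p q → p ≠ q ∧ ∀ c c', G.Adj (u (idx p c + 1)) (u (idx q c')))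
    (Z : Finset P) (f : P → P) (hf : Set.BijOn f Z Z) (hsegZ : Set.InjOn seg (Z : Set P))
    (hfD : ∀ p ∈ Z, D p (f p)) (Q : Finset (P × P)) (hQZ : Q ⊆ Z ×ˢ Z)
    (hQ : ∀ c ∈ Q, c.1 ≠ c.2 ∧ D c.1 (f c.2) ∧ D c.2 (f c.1)) :
    ∃ C' : SimpleGraph V, C' ≤ G ∧ IsHamCycleOn C' ∧ E₀ ⊆ C'.edgeSet ∧
      Q.card ≤ 2 * auxEdgeCount G C' := by
  classical
  have hseg' : ∀ p c k, k ≤ 2 → (idx p c + k) / L = seg p := by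
    intro p c k hk
    have h1 := hend p c
    have h2 := Nat.div_add_mod (idx p c) L
    rw [hseg] at h2
    refine Nat.div_eq_of_lt_le ?_ ?_
    · rw [mul_comm]
      omega
    · rw [add_mul, mul_comm]
      omega
  have huniq : ∀ p ∈ Z, ∀ q ∈ Z, ∀ c c' k k', k ≤ 2 → k' ≤ 2 →
      u (idx p c + k) = u (idx q c' + k') → p = q ∧ idx p c + k = idx q c' + k' := by
    intro p hp q hq c c' k k' hk hk' h
    have hpc := hn p c
    have hqc := hn q c'
    have heq := huinj _ (by omega) _ (by omega) h
    refine ⟨hsegZ hp hq ?_, heq⟩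
    rw [← hseg' p c k hk, heq, hseg' q c' k' hk']
  have hmin : ∀ p c, idx p false ≤ idx p c := by
    intro p c
    cases c
    exacts [le_rfl, (hlt p).le]
  let e : ↥(Z : Set P) × Bool ↪ V := ⟨fun z => u (idx z.1 z.2), by
    rintro ⟨⟨p, hp⟩, c⟩ ⟨⟨q, hq⟩, c'⟩ h
    obtain ⟨rfl, h'⟩ := huniq p hp q hq c c' 0 0 (by omega) (by omega) h
    have := hlt p
    cases c <;> cases c' <;> first | rfl | (exfalso; omega)⟩
  have he : ∀ p (hp : p ∈ Z) c, e (⟨p, hp⟩, c) = u (idx p c) := fun _ _ _ => rfl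
  have hpow : ∀ m k, (τ ^ m) (u k) = u (k + m) := by
    intro m k
    induction m with
    | zero => rfl
    | succ m ih => rw [pow_succ', Equiv.Perm.mul_apply, ih, hu, add_assoc]
  obtain ⟨τ', hτ', hoff, hon⟩ := Equiv.Perm.exists_reroute hτ (hf.equiv f) e (by
    rintro ⟨p, hp⟩
    have hpp := hlt p
    have hpn := hn p true
    refine ⟨idx p true - idx p false - 1, ?_, ?_⟩
    · rw [he, he, hu, hpow]
      congr 1
      omega
    · rintro j hj ⟨⟨⟨q, hq⟩, c⟩, h⟩
      rw [he, he, hu, hpow] at h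
      have hqn := hn q c
      have h' := huinj _ (by omega) _ (by omega) h
      have hpq : q = p := by
        refine hsegZ hq hp (le_antisymm ?_ ?_)
        · rw [← hseg p true, ← hseg q c, h']
          exact Nat.div_le_div_right (by omega)
        · rw [← hseg p false, ← hseg q c, h']
          exact Nat.div_le_div_right (by omega)
      subst hpq
      cases c <;> omega)
  have hτfix := Equiv.Perm.apply_apply_ne_of_forall_sameCycle hτ' hcard
  have hadj : ∀ a, τ'.cycleGraph.Adj a (τ' a) := fun a =>
    ⟨fun h => hτfix a (by rw [← h, ← h]), Or.inl rfl⟩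
  have hon' : ∀ p ∈ Z, ∀ c, ∃ c', τ' (u (idx (f p) c)) = u (idx p c' + 1) := by
    intro p hp c
    obtain ⟨c', hc'⟩ := hon ⟨p, hp⟩ c
    exact ⟨c', by rw [← hu]; exact hc'⟩
  have hrange : ∀ a ∈ Set.range e, ∃ p ∈ Z, ∃ c, a = u (idx (f p) c) := by
    rintro _ ⟨⟨⟨q, hq⟩, c⟩, rfl⟩
    obtain ⟨p, hp, rfl⟩ := hf.surjOn hq
    exact ⟨p, hp, c, rfl⟩
  have hG : ∀ a, G.Adj a (τ' a) := by
    intro a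
    by_cases ha : a ∈ Set.range e
    · obtain ⟨p, hp, c, rfl⟩ := hrange a ha
      obtain ⟨c', hc'⟩ := hon' p hp c
      rw [hc']
      exact ((hD p _ (hfD p hp)).2 c' c).symm
    · rw [hoff a ha]
      exact hCG ((hCτ _ _).mpr (Or.inl rfl))
  have hkeep : ∀ a, s(a, τ a) ∈ E₀ → τ' a = τ a := by
    intro a ha
    refine hoff a fun ⟨⟨⟨q, hq⟩, c⟩, h⟩ => ?_
    rw [he] at h
    rw [← h, hu] at ha
    exact hidx q c ha
  choose! cc hcc using fun p hp => hon' p hp false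
  set x : P → V := fun p => u (idx (f p) false) with hx
  set y : P → V := fun p => u (idx p (cc p) + 1) with hy
  have hxy : ∀ p ∈ Z, τ' (x p) = y p := hcc
  have hyx : ∀ p ∈ Z, ∀ q ∈ Z, D p (f q) → y p ≠ x q := by
    intro p hp q hq hpq h
    exact (hD _ _ hpq).1 (huniq p hp (f q) (hf.mapsTo hq) _ _ 1 0 (by omega) (by omega) h).1
  have hyy : ∀ p ∈ Z, ∀ q ∈ Z, p ≠ q → y p ≠ y q := by
    intro p hp q hq hpq h
    exact hpq (huniq p hp q hq _ _ 1 1 (by omega) (by omega) h).1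
  have hxx : ∀ p ∈ Z, ∀ q ∈ Z, p ≠ q → x p ≠ x q := by
    intro p hp q hq hpq h
    exact hpq (hf.injOn hp hq
      (huniq _ (hf.mapsTo hp) _ (hf.mapsTo hq) _ _ 0 0 (by omega) (by omega) h).1)
  have hnadj : ∀ p ∈ Z, ∀ q ∈ Z, p ≠ q → D p (f q) → ¬ τ'.cycleGraph.Adj (y p) (x q) := by
    rintro p hp q hq hpq hpfq ⟨-, h | h⟩
    · by_cases hr : y p ∈ Set.range e
      · obtain ⟨r, hr, c, hrc⟩ := hrange _ hr
        obtain ⟨c', hc'⟩ := hon' r hr c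
        rw [hrc, hc'] at h
        obtain ⟨rfl, h'⟩ :=
          huniq r hr (f q) (hf.mapsTo hq) _ _ 1 0 (by omega) (by omega) h
        have := hmin (f q) c'
        omega
      · rw [hoff _ hr, hy] at h
        simp only [hu] at h
        exact (hD _ _ hpfq).1
          (huniq p hp (f q) (hf.mapsTo hq) _ _ 2 0 (by omega) (by omega) h).1
    · rw [hxy q hq] at h
      exact hyy q hq p hp hpq.symm h
  refine ⟨τ'.cycleGraph, ?_, Equiv.Perm.isHamCycleOn_cycleGraph hτ' hcard, ?_, ?_⟩
  · rintro a b ⟨-, rfl | rfl⟩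
    exacts [hG a, (hG b).symm]
  · intro ed
    induction ed using Sym2.ind with
    | _ a b =>
    intro hab
    have hC : C.Adj a b := hE₀ hab
    rw [SimpleGraph.mem_edgeSet]
    rcases (hCτ a b).mp hC with rfl | rfl
    · rw [← hkeep a hab]
      exact hadj a
    · rw [Sym2.eq_swap] at hab
      rw [← hkeep b hab]
      exact (hadj b).symm
  · refine card_le_two_mul_ncard_of_injOn Z Q hQZ (fun p => s(x p, y p)) ?_ _ ?_
    · intro p hp q hq h
      by_contra hpq
      rcases Sym2.eq_iff.mp h with ⟨h1, -⟩ | ⟨h1, h2⟩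
      · exact hxx p hp q hq hpq h1
      · refine hτfix (x p) ?_
        rw [hxy p hp, h2, hxy q hq, h1]
    · rintro ⟨p, q⟩ hc
      obtain ⟨hp, hq⟩ := mem_product.mp (hQZ hc)
      obtain ⟨hpq, h1, h2⟩ := hQ _ hc
      simp only at hp hq hpq h1 h2
      have hdisj : ∀ v, ¬ (v ∈ s(x p, y p) ∧ v ∈ s(x q, y q)) := by
        rintro v ⟨hv1, hv2⟩
        rcases Sym2.mem_iff.mp hv1 with rfl | rfl <;> rcases Sym2.mem_iff.mp hv2 with h | h
        · exact hxx p hp q hq hpq h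
        · exact hyx q hq p hp h2 h.symm
        · exact hyx p hp q hq h1 h
        · exact hyy p hp q hq hpq h
      refine ⟨s(x p, y p), s(x q, y q), ⟨?_, ?_, ?_, hdisj, x p, y p, x q, y q, rfl, rfl,
        (hD _ _ h1).2 _ _, (hD _ _ h2).2 _ _, hnadj p hp q hq hpq h1,
        hnadj q hq p hp (Ne.symm hpq) h2⟩, rfl⟩
      · rw [SimpleGraph.mem_edgeSet, ← hxy p hp]
        exact hadj _
      · rw [SimpleGraph.mem_edgeSet, ← hxy q hq]
        exact hadj _
      · intro h
        exact hdisj (x p) ⟨Sym2.mem_mk_left _ _, h ▸ Sym2.mem_mk_left _ _⟩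

/-- The forward orbit of a permutation with a single orbit enumerates the whole set. -/
lemma Equiv.Perm.exists_orbit_enumeration {V : Type*} [Fintype V] {τ : Equiv.Perm V}
    (hτ : ∀ u v, τ.SameCycle u v) (v : V) :
    ∃ u : ℕ → V, (∀ k, τ (u k) = u (k + 1)) ∧
      (∀ i < Fintype.card V, ∀ j < Fintype.card V, u i = u j → i = j) ∧
      ∀ w, ∃ i < Fintype.card V, u i = w := by
  have hcyc : τ.IsCycleOn ((univ : Finset V) : Set V) :=
    ⟨by simp [Set.bijOn_univ], fun x _ y _ => hτ x y⟩
  refine ⟨fun k => (τ ^ k) v, fun k => ?_, fun i hi j hj h => ?_, fun w => ?_⟩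
  · simp only [pow_succ', Equiv.Perm.mul_apply]
  · have := (hcyc.pow_apply_eq_pow_apply (mem_univ v)).mp h
    exact Nat.ModEq.eq_of_lt_of_lt this hi hj
  · exact hcyc.exists_pow_eq (mem_univ v) (mem_univ w)

/-- A dense vertex set meets the admissible positions of an enumeration in a dense set. -/
lemma card_le_mul_card_filter_of_bad_le {V : Type*} [Fintype V] [DecidableEq V] {u : ℕ → V}
    (hsurj : ∀ w, ∃ i < Fintype.card V, u i = w) (valid : ℕ → Prop) [DecidablePred valid] {a b : ℕ}
    (hbad : ((range (Fintype.card V)).filter fun i => ¬ valid i).card ≤ b)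
    (hb : 2 * a * b ≤ Fintype.card V) (W : Finset V) (hW : Fintype.card V ≤ a * W.card) :
    Fintype.card V ≤ 2 * a * ((range (Fintype.card V)).filter fun i => valid i ∧ u i ∈ W).card := by
  set n := Fintype.card V
  have hsub : W ⊆ (((range n).filter fun i => valid i ∧ u i ∈ W) ∪
      (range n).filter fun i => ¬ valid i).image u := by
    intro w hw
    obtain ⟨i, hi, rfl⟩ := hsurj w
    refine mem_image_of_mem _ ?_
    by_cases h : valid i <;> simp [h, hi, hw]
  have h1 : W.card ≤ ((range n).filter fun i => valid i ∧ u i ∈ W).card + b :=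
    (card_le_card hsub).trans (card_image_le.trans ((card_union_le _ _).trans
      (Nat.add_le_add_left hbad _)))
  have h2 := Nat.mul_le_mul_left a h1
  rw [mul_add] at h2
  rw [mul_assoc] at hb ⊢
  omega

/-- Pairs of indices in a common block are determined by an index and a remainder. -/
lemma card_le_mul_of_div_eq {n L : ℕ} (hL : 0 < L) (S : Finset (ℕ × ℕ))
    (hS : ∀ c ∈ S, c.1 < n ∧ c.1 / L = c.2 / L) : S.card ≤ n * L := by
  suffices h : S.card ≤ (range n ×ˢ range L).card by simpa using h
  refine card_le_card_of_injOn (fun c => (c.1, c.2 % L)) (fun c hc => ?_) ?_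
  · simp [(hS c hc).1, Nat.mod_lt _ hL]
  · rintro ⟨a, b⟩ hc ⟨a', b'⟩ hc' h
    simp only [Prod.mk.injEq] at h ⊢
    refine ⟨h.1, ?_⟩
    have h1 := (hS _ hc).2
    have h2 := (hS _ hc').2
    simp only at h1 h2
    rw [← Nat.div_add_mod b L, ← Nat.div_add_mod b' L, ← h1, ← h2, h.1, h.2]

lemma card_filter_div_eq_le {L : ℕ} (hL : 0 < L) (m : ℕ) (S : Finset (ℕ × ℕ))
    (hS : ∀ c ∈ S, c.1 / L = m ∧ c.2 / L = m) : S.card ≤ L ^ 2 := by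
  suffices h : S.card ≤ (range L ×ˢ range L).card by simpa [sq] using h
  refine card_le_card_of_injOn (fun c => (c.1 % L, c.2 % L)) (fun c hc => ?_) ?_
  · simp [Nat.mod_lt _ hL]
  · rintro ⟨a, b⟩ hc ⟨a', b'⟩ hc' h
    simp only [Prod.mk.injEq] at h ⊢
    have h1 := hS _ hc
    have h2 := hS _ hc'
    simp only at h1 h2
    rw [← Nat.div_add_mod b L, ← Nat.div_add_mod b' L, ← Nat.div_add_mod a L,
      ← Nat.div_add_mod a' L, h1.1, h2.1, h1.2, h2.2, h.1, h.2]
    exact ⟨rfl, rfl⟩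

lemma four_mul_sq_mul_index_bound_le {A n e : ℕ} (hA : 16 ≤ A) (hn : A ^ 4 ≤ n) (he : A ^ 10 * e ≤ n) :
    2 * (2 * A ^ 2) * (2 * (n / A ^ 8 + 1) + 2 + e) ≤ n := by
  have h1 : A ^ 8 * (n / A ^ 8) ≤ n := Nat.mul_div_le _ _
  set d := n / A ^ 8
  have h2 : 16 ^ 6 * (A ^ 2 * d) ≤ n := by
    refine le_trans ?_ h1
    rw [show A ^ 8 * d = A ^ 6 * (A ^ 2 * d) by ring]
    exact Nat.mul_le_mul_right _ (Nat.pow_le_pow_left hA 6)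
  have h3 : 16 ^ 8 * (A ^ 2 * e) ≤ n := by
    refine le_trans ?_ he
    rw [show A ^ 10 * e = A ^ 8 * (A ^ 2 * e) by ring]
    exact Nat.mul_le_mul_right _ (Nat.pow_le_pow_left hA 8)
  have h4 : 16 ^ 2 * A ^ 2 ≤ n := by
    refine le_trans ?_ hn
    rw [show A ^ 4 = A ^ 2 * A ^ 2 by ring]
    exact Nat.mul_le_mul_right _ (Nat.pow_le_pow_left hA 2)
  have h6 : 2 * (2 * A ^ 2) * (2 * (d + 1) + 2 + e) = 8 * (A ^ 2 * d) + 16 * A ^ 2 +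
    4 * (A ^ 2 * e) := by ring
  omega

/-- Main combinatorial statement: a Hamilton cycle of a dense graph can be rerouted, while keeping
a prescribed small set of edges, to a Hamilton cycle with many auxiliary edges. -/
theorem exists_isHamCycleOn_sq_le_auxEdgeCount {V : Type*} [Fintype V] {G C : SimpleGraph V}
    (hCG : C ≤ G) (hC : IsHamCycleOn C) {A T : ℕ} (hA : 16 ≤ A)
    (hdeg : ∀ v, Fintype.card V ≤ A * (G.neighborSet v).ncard) (E₀ : Set (Sym2 V))
    (hE₀ : E₀ ⊆ C.edgeSet) (hE₀c : A ^ 10 * E₀.ncard ≤ Fintype.card V) (hT : 0 < T)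
    (hn : 1024 * T * A ^ 146 < Fintype.card V)
    (hexp : 4 * (Fintype.card V * A ^ 8) * (A ^ 19 - 1) ^ (A ^ 20) ≤ (A ^ 19) ^ (A ^ 20)) :
    ∃ C' : SimpleGraph V, C' ≤ G ∧ IsHamCycleOn C' ∧ E₀ ⊆ C'.edgeSet ∧
      T ^ 2 ≤ 128 * A ^ 80 * auxEdgeCount G C' := by
  classical
  obtain ⟨hcard, τ, hτ, hCτ⟩ := hC.exists_perm
  obtain ⟨v₀⟩ : Nonempty V := Fintype.card_pos_iff.mp (by omega)
  obtain ⟨u, hu, huinj, husurj⟩ := Equiv.Perm.exists_orbit_enumeration hτ v₀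
  have hpow : ∀ k, k ≤ 146 → 1024 * A ^ k ≤ Fintype.card V := fun k hk => by
    refine le_trans ?_ hn.le
    rw [mul_right_comm]
    exact (Nat.mul_le_mul_left _ (Nat.pow_le_pow_right (by omega) hk)).trans
      (Nat.le_mul_of_pos_right _ hT)
  have hApos : ∀ k, 0 < A ^ k := fun k => Nat.pow_pos (by omega)
  set n := Fintype.card V with hnV
  let bad : ℕ → Prop := fun i => s(u i, u (i + 1)) ∈ E₀
  let valid : ℕ → Prop := fun i => i % A ^ 8 + 2 < A ^ 8 ∧ i + 2 < n ∧ ¬ bad i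
  let Nb : ℕ → Finset V := fun i => (G.neighborSet (u (i + 1))).toFinset
  have hNb : ∀ i, n ≤ A * (Nb i).card := fun i => by
    simpa only [Nb, ← Set.ncard_eq_toFinset_card'] using hdeg (u (i + 1))
  have hmemNb : ∀ i v, v ∈ Nb i ↔ G.Adj (u (i + 1)) v := fun i v => by simp [Nb]
  have hbad : ((range n).filter bad).card ≤ E₀.ncard := by
    rw [← Set.ncard_coe_finset]
    refine Set.ncard_le_ncard_of_injOn (fun i => s(u i, u (i + 1))) ?_ ?_ E₀.toFinite
    · intro i hi
      exact (mem_filter.mp hi).2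
    · intro i hi j hj h
      have hi' := mem_range.mp (mem_filter.mp hi).1
      have hj' := mem_range.mp (mem_filter.mp hj).1
      rcases Sym2.eq_iff.mp h with ⟨h1, -⟩ | ⟨h1, h2⟩
      · exact huinj i hi' j hj' h1
      · refine absurd ?_ (Equiv.Perm.apply_apply_ne_of_forall_sameCycle hτ hcard (u j))
        rw [hu, ← h1, hu, h2]
  have hinvalid : ((range n).filter fun i => ¬ valid i).card ≤
      2 * (n / A ^ 8 + 1) + 2 + E₀.ncard :=
    (card_filter_bad_index_le (hApos 8) bad).trans (Nat.add_le_add_left hbad _)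
  have hvalid : ∀ W : Finset V, n ≤ 2 * A ^ 2 * W.card →
      n ≤ 4 * A ^ 2 * ((range n).filter fun i => valid i ∧ u i ∈ W).card := by
    intro W hW
    have h := card_le_mul_card_filter_of_bad_le husurj valid hinvalid
      (four_mul_sq_mul_index_bound_le hA (by have := hpow 4 (by omega); omega) hE₀c) W hW
    rwa [← mul_assoc] at h
  let R : ℕ × ℕ → Prop := fun c => c.1 < c.2 ∧ c.1 / A ^ 8 = c.2 / A ^ 8 ∧
    n ≤ 2 * A ^ 2 * (Nb c.1 ∩ Nb c.2).card
  let S : Finset (ℕ × ℕ) := (((range n).filter valid) ×ˢ ((range n).filter valid)).filter R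
  have hS : ∀ c, c ∈ S ↔ ((c.1 < n ∧ valid c.1) ∧ c.2 < n ∧ valid c.2) ∧ R c := by
    simp [S]
  have hdense : ∀ W : Finset V, n ≤ 2 * A ^ 2 * W.card →
      n ≤ 8 * A ^ 10 * (S.filter fun c => u c.1 ∈ W ∧ u c.2 ∈ W).card := by
    intro W hW
    refine (le_mul_card_dense_pairs (by omega) (by have := hpow 4 (by omega); omega) Nb hNb
      ((range n).filter fun i => valid i ∧ u i ∈ W) (filter_subset _ _) (hvalid W hW)).trans
      (Nat.mul_le_mul_left _ (card_le_card ?_))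
    intro c hc
    simp only [mem_filter, mem_product, mem_range] at hc
    rw [mem_filter, hS]
    exact ⟨⟨⟨⟨hc.1.1.1, hc.1.1.2.1⟩, hc.1.2.1, hc.1.2.2.1⟩, hc.2⟩, hc.1.1.2.2, hc.1.2.2.2⟩
  have hScard : S.card ≤ n * A ^ 8 :=
    card_le_mul_of_div_eq (hApos 8) S fun c hc => ⟨((hS c).mp hc).1.1.1, ((hS c).mp hc).2.2.1⟩
  have hScard' : n ≤ 8 * A ^ 10 * S.card := by
    refine (hdense univ ?_).trans (Nat.mul_le_mul_left _ (card_filter_le _ _))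
    rw [card_univ]
    exact Nat.le_mul_of_pos_left _ (Nat.mul_pos two_pos (hApos 2))
  let idx : {c // c ∈ S} → Bool → ℕ := fun p c => bif c then p.1.2 else p.1.1
  let seg : {c // c ∈ S} → ℕ := fun p => p.1.1 / A ^ 8
  let D : {c // c ∈ S} → {c // c ∈ S} → Prop := fun p q =>
    p ≠ q ∧ ∀ c c', G.Adj (u (idx p c + 1)) (u (idx q c'))
  have hcardP : Fintype.card {c // c ∈ S} = S.card := Fintype.card_coe S
  have hK : ∀ m, (univ.filter fun p => seg p = m).card ≤ A ^ 16 := by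
    intro m
    rw [← card_map (Function.Embedding.subtype _)]
    refine (card_filter_div_eq_le (hApos 8) m _ fun c hc => ?_).trans (by rw [← pow_mul])
    obtain ⟨p, hp, rfl⟩ := mem_map.mp hc
    have h1 : p.1.1 / A ^ 8 = m := (mem_filter.mp hp).2
    have h2 := ((hS _).mp p.2).2.2.1
    exact ⟨h1, h2 ▸ h1⟩
  have hout : ∀ p, Fintype.card {c // c ∈ S} ≤ A ^ 19 * (univ.filter (D p)).card := by
    intro p
    have hp := (hS _).mp p.2
    have h1 := hdense _ hp.2.2.2
    have h2 : (S.filter fun c => u c.1 ∈ Nb p.1.1 ∩ Nb p.1.2 ∧ u c.2 ∈ Nb p.1.1 ∩ Nb p.1.2) ⊆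
        insert p.1 ((univ.filter (D p)).map (Function.Embedding.subtype _)) := by
      intro c hc
      simp only [mem_filter, mem_inter, hmemNb] at hc
      obtain ⟨hcS, ⟨h11, h12⟩, h21, h22⟩ := hc
      rw [mem_insert, mem_map]
      refine or_iff_not_imp_left.mpr fun hcp => ⟨⟨c, hcS⟩, ?_, rfl⟩
      refine mem_filter.mpr ⟨mem_univ _, fun h => hcp (by rw [h]), ?_⟩
      rintro (_ | _) (_ | _)
      exacts [h11, h21, h12, h22]
    have h3 := (card_le_card h2).trans (card_insert_le _ _)
    rw [card_map] at h3
    set d := (univ.filter (D p)).card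
    have h4 : n ≤ 16 * A ^ 10 * d := by
      have h5 := h1.trans (Nat.mul_le_mul_left _ h3)
      have h6 := hpow 10 (by omega)
      rw [mul_add, mul_one, mul_assoc] at h5
      rw [mul_assoc]
      omega
    rw [hcardP]
    calc S.card ≤ n * A ^ 8 := hScard
      _ ≤ 16 * A ^ 10 * d * A ^ 8 := Nat.mul_le_mul_right _ h4
      _ = 16 * (A ^ 18 * d) := by ring
      _ ≤ A * (A ^ 18 * d) := Nat.mul_le_mul_right _ hA
      _ = A ^ 19 * d := by ring
  have hlarge : 4 * (A ^ 20) ^ 2 * A ^ 16 ≤ Fintype.card {c // c ∈ S} := by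
    rw [hcardP]
    refine Nat.le_of_mul_le_mul_left (le_trans ?_ hScard') (Nat.mul_pos (by norm_num) (hApos 10))
    have h := hpow 66 (by omega)
    rw [show 8 * A ^ 10 * (4 * (A ^ 20) ^ 2 * A ^ 16) = 32 * A ^ 66 by ring]
    omega
  have hlarge' : 128 * T * (A ^ 20) ^ 6 * A ^ 16 < Fintype.card {c // c ∈ S} := by
    rw [hcardP]
    refine Nat.lt_of_mul_lt_mul_left (a := 8 * A ^ 10) (lt_of_lt_of_le ?_ hScard')
    rwa [show 8 * A ^ 10 * (128 * T * (A ^ 20) ^ 6 * A ^ 16) = 1024 * T * A ^ 146 by ring]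
  obtain ⟨Z, f, hf, hsegZ, hfD, hZ⟩ := exists_bijOn_of_outdegree D (fun p h => h.1 rfl) seg hK hout
    (hApos 20) hT hlarge ((Nat.mul_le_mul_right _ (Nat.mul_le_mul_left _
      (hcardP.trans_le hScard))).trans hexp) hlarge'
  obtain ⟨C', h1, h2, h3, h4⟩ := exists_isHamCycleOn_of_bijOn hCG hτ hcard hCτ u hu huinj E₀ hE₀
    (L := A ^ 8) idx seg (fun p => ((hS _).mp p.2).2.1)
    (by
      rintro p (_ | _)
      exacts [rfl, ((hS _).mp p.2).2.2.1.symm])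
    (by
      rintro p (_ | _)
      exacts [((hS _).mp p.2).1.1.2.1, ((hS _).mp p.2).1.2.2.1])
    (by
      rintro p (_ | _)
      exacts [((hS _).mp p.2).1.1.2.2.1, ((hS _).mp p.2).1.2.2.2.1])
    (by
      rintro p (_ | _)
      exacts [((hS _).mp p.2).1.1.2.2.2, ((hS _).mp p.2).1.2.2.2.2])
    D (fun p q h => h) Z f hf hsegZ hfD _ (filter_subset _ _) (fun c hc => (mem_filter.mp hc).2)
  refine ⟨C', h1, h2, h3, hZ.trans ?_⟩
  calc _ ≤ 64 * (A ^ 20) ^ 4 * (2 * auxEdgeCount G C') := Nat.mul_le_mul_left _ h4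
    _ = _ := by ring

lemma mul_pow_sub_one_le_pow {m B A : ℕ} (hB : 0 < B) (hm : (m : ℝ) ≤ Real.exp A) :
    m * (B - 1) ^ (B * A) ≤ B ^ (B * A) := by
  have hB' : (0 : ℝ) < B := Nat.cast_pos.mpr hB
  have h1 : ((B - 1 : ℕ) : ℝ) ≤ B * Real.exp (-(1 / B)) := by
    rw [Nat.cast_pred hB]
    have h := Real.add_one_le_exp (-(1 / (B : ℝ)))
    calc (B : ℝ) - 1 = B * (-(1 / B) + 1) := by field_simp; ring
      _ ≤ _ := mul_le_mul_of_nonneg_left h hB'.le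
  have h2 : ((B - 1 : ℕ) : ℝ) ^ (B * A) ≤ (B : ℝ) ^ (B * A) * Real.exp (-A) := by
    calc _ ≤ (B * Real.exp (-(1 / B))) ^ (B * A) := pow_le_pow_left₀ (Nat.cast_nonneg _) h1 _
      _ = _ := by
        rw [mul_pow, ← Real.exp_nat_mul]
        congr 2
        push_cast
        field_simp
  have h3 : (m : ℝ) * ((B - 1 : ℕ) : ℝ) ^ (B * A) ≤ (B : ℝ) ^ (B * A) := by
    calc _ ≤ Real.exp A * ((B : ℝ) ^ (B * A) * Real.exp (-A)) :=
          mul_le_mul hm h2 (by positivity) (Real.exp_pos _).le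
      _ = (B : ℝ) ^ (B * A) * (Real.exp A * Real.exp (-A)) := by ring
      _ = _ := by rw [← Real.exp_add, add_neg_cancel, Real.exp_zero, mul_one]
  exact_mod_cast h3

lemma eventually_four_mul_sq_le_exp_rpow {ε : ℝ} (hε : 0 < ε) :
    ∀ᶠ n : ℕ in Filter.atTop, 16 ≤ (n : ℝ) ^ ε ∧ 4 * (n : ℝ) ^ 2 ≤ Real.exp ((n : ℝ) ^ ε) := by
  have ht : Filter.Tendsto (fun n : ℕ => (n : ℝ) ^ ε) Filter.atTop Filter.atTop :=
    (tendsto_rpow_atTop hε).comp tendsto_natCast_atTop_atTop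
  have h1 := (isLittleO_rpow_exp_atTop (2 / ε)).bound (show (0 : ℝ) < 1 / 4 by norm_num)
  filter_upwards [ht.eventually h1, ht.eventually_ge_atTop 16] with n hn hn'
  refine ⟨hn', ?_⟩
  have h2 : ((n : ℝ) ^ ε) ^ (2 / ε) = (n : ℝ) ^ 2 := by
    rw [← Real.rpow_mul (Nat.cast_nonneg n), mul_div_cancel₀ _ hε.ne']
    exact_mod_cast Real.rpow_natCast (n : ℝ) 2
  rw [h2, Real.norm_of_nonneg (by positivity), Real.norm_of_nonneg (Real.exp_pos _).le] at hn
  linarith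

end

theorem stmt11 (η : ℝ) (hη0 : 0 < η) (hη1 : η ≤ 1) :
    ∃ ε₀ : ℝ, 0 < ε₀ ∧ ∀ ε : ℝ, 0 < ε → ε ≤ ε₀ →
      ∃ n₀ : ℕ, ∀ n : ℕ, n₀ ≤ n →
        ∀ G C : SimpleGraph (Fin n), C ≤ G → IsHamCycleOn C →
          (∀ v : Fin n, (n : ℝ) ^ (1 - ε) ≤ ((G.neighborSet v).ncard : ℝ)) →
          ∀ E₀ : Set (Sym2 (Fin n)), E₀ ⊆ C.edgeSet → (E₀.ncard : ℝ) ≤ (n : ℝ) ^ (1 - η) →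
            ∃ C' : SimpleGraph (Fin n), C' ≤ G ∧ IsHamCycleOn C' ∧ E₀ ⊆ C'.edgeSet ∧
              (n : ℝ) ^ (2 - η) ≤ (auxEdgeCount G C' : ℝ) := by
  refine ⟨η / 1000, by positivity, fun ε hε hε' => ?_⟩
  obtain ⟨n₀, hn₀⟩ := Filter.eventually_atTop.mp (eventually_four_mul_sq_le_exp_rpow hε)
  refine ⟨max n₀ 1, fun n hn G C hCG hC hdeg E₀ hE₀ hE₀c => ?_⟩
  obtain ⟨h16, hexp⟩ := hn₀ n (le_trans (le_max_left _ _) hn)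
  have hn1 : (1 : ℝ) ≤ n := by exact_mod_cast le_trans (le_max_right _ _) hn
  have hn0 : (0 : ℝ) < n := by linarith
  set A : ℕ := ⌈(n : ℝ) ^ ε⌉₊ with hA
  have hAge : (n : ℝ) ^ ε ≤ A := Nat.le_ceil _
  have hA16 : 16 ≤ A := by exact_mod_cast h16.trans hAge
  have hA1 : (1 : ℝ) ≤ A := by exact_mod_cast (by omega : 1 ≤ A)
  have hAle : (A : ℝ) ≤ (n : ℝ) ^ (2 * ε) := by
    have h1 : (A : ℝ) < (n : ℝ) ^ ε + 1 := Nat.ceil_lt_add_one (by positivity)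
    rw [two_mul, Real.rpow_add hn0]
    nlinarith
  have hAη : (A : ℝ) ^ 381 ≤ (n : ℝ) ^ η := by
    calc (A : ℝ) ^ 381 ≤ ((n : ℝ) ^ (2 * ε)) ^ 381 := pow_le_pow_left₀ (by positivity) hAle _
      _ = (n : ℝ) ^ (2 * ε * 381) := by
        exact_mod_cast (Real.rpow_mul_natCast hn0.le (2 * ε) 381).symm
      _ ≤ _ := Real.rpow_le_rpow_of_exponent_le hn1 (by linarith)
  have hAn : ∀ k ≤ 381, A ^ k ≤ n := fun k hk => by
    have h1 : (A : ℝ) ^ k ≤ n :=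
      calc (A : ℝ) ^ k ≤ (A : ℝ) ^ 381 := pow_le_pow_right₀ hA1 hk
        _ ≤ (n : ℝ) ^ η := hAη
        _ ≤ (n : ℝ) ^ (1 : ℝ) := Real.rpow_le_rpow_of_exponent_le hn1 hη1
        _ = n := Real.rpow_one _
    exact_mod_cast h1
  have hpos : ∀ k, 0 < A ^ k := fun k => Nat.pow_pos (by omega)
  set T : ℕ := n / A ^ 149 with hTdef
  have hT : 0 < T := Nat.div_pos (hAn 149 (by norm_num)) (hpos 149)
  have hTle : T * A ^ 149 ≤ n := Nat.div_mul_le_self _ _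
  have hTge : n ≤ 2 * T * A ^ 149 := by
    have h1 := Nat.lt_div_mul_add (hpos 149) (a := n)
    rw [← hTdef] at h1
    have h2 : A ^ 149 ≤ T * A ^ 149 := Nat.le_mul_of_pos_left _ hT
    rw [mul_assoc]
    omega
  obtain ⟨C', h1, h2, h3, h4⟩ := exists_isHamCycleOn_sq_le_auxEdgeCount hCG hC hA16 (T := T)
    (fun v => by
      rw [Fintype.card_fin]
      have h : (n : ℝ) ≤ A * ((G.neighborSet v).ncard : ℝ) :=
        calc (n : ℝ) = (n : ℝ) ^ ε * (n : ℝ) ^ (1 - ε) := by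
              rw [← Real.rpow_add hn0, add_sub_cancel, Real.rpow_one]
          _ ≤ _ := mul_le_mul hAge (hdeg v) (by positivity) (by positivity)
      exact_mod_cast h) E₀ hE₀
    (by
      rw [Fintype.card_fin]
      have h : (A : ℝ) ^ 10 * (E₀.ncard : ℝ) ≤ n :=
        calc (A : ℝ) ^ 10 * (E₀.ncard : ℝ) ≤ (n : ℝ) ^ η * (n : ℝ) ^ (1 - η) :=
              mul_le_mul ((pow_le_pow_right₀ hA1 (by norm_num)).trans hAη) hE₀c
                (by positivity) (by positivity)
          _ = n := by rw [← Real.rpow_add hn0, add_sub_cancel, Real.rpow_one]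
      exact_mod_cast h) hT
    (by
      rw [Fintype.card_fin]
      refine lt_of_lt_of_le ?_ hTle
      rw [show T * A ^ 149 = A ^ 3 * (T * A ^ 146) by ring, mul_assoc]
      refine Nat.mul_lt_mul_of_pos_right ?_ (Nat.mul_pos hT (hpos 146))
      exact lt_of_lt_of_le (by norm_num) (Nat.pow_le_pow_left hA16 3))
    (by
      rw [Fintype.card_fin, show A ^ 20 = A ^ 19 * A from pow_succ _ _]
      refine mul_pow_sub_one_le_pow (hpos 19) ?_
      have h : (A : ℝ) ^ 8 ≤ n := by exact_mod_cast hAn 8 (by norm_num)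
      push_cast
      calc 4 * ((n : ℝ) * (A : ℝ) ^ 8) ≤ 4 * (n : ℝ) ^ 2 := by nlinarith
        _ ≤ Real.exp ((n : ℝ) ^ ε) := hexp
        _ ≤ Real.exp A := Real.exp_le_exp.mpr hAge)
  refine ⟨C', h1, h2, h3, ?_⟩
  set x := auxEdgeCount G C'
  have h5 : n ^ 2 ≤ A ^ 381 * x := by
    calc n ^ 2 ≤ (2 * T * A ^ 149) ^ 2 := Nat.pow_le_pow_left hTge 2
      _ = 4 * A ^ 298 * T ^ 2 := by ring
      _ ≤ 4 * A ^ 298 * (128 * A ^ 80 * x) := Nat.mul_le_mul_left _ h4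
      _ = 512 * (A ^ 378 * x) := by ring
      _ ≤ A ^ 3 * (A ^ 378 * x) :=
        Nat.mul_le_mul_right _ (le_trans (by norm_num) (Nat.pow_le_pow_left hA16 3))
      _ = A ^ 381 * x := by ring
  have h6 : (n : ℝ) ^ 2 ≤ (n : ℝ) ^ η * x :=
    calc (n : ℝ) ^ 2 ≤ (A : ℝ) ^ 381 * x := by exact_mod_cast h5
      _ ≤ _ := mul_le_mul_of_nonneg_right hAη (Nat.cast_nonneg _)
  rw [Real.rpow_sub hn0, div_le_iff₀ (Real.rpow_pos_of_pos hn0 _), mul_comm (x : ℝ)]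
  exact_mod_cast h6
end

section
/- For every real δ with 0 < δ ≤ 1 there exist η₀ > 0 and, for each η ∈ (0, η₀], an n₀ ∈ ℕ such that the following holds for all n ≥ n₀. Let G be an n-vertex graph containing a 2-factor 𝒞 consisting of exactly ℓ cycles, where 1 ≤ ℓ ≤ n^{1−δ}. If e(H_𝒞) ≥ n^{2−η} and k is an integer with ℓ ≤ k ≤ n^{1−δ}, then G contains a 2-factor consisting of exactly k cycles. -/
/-- `H` is a 2-factor of `G`: a spanning 2-regular subgraph of `G`
(viewed as a graph on the same vertex set). -/
def IsTwoFactor {V : Type*} (G H : SimpleGraph V) : Prop :=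
  H ≤ G ∧ ∀ v : V, (H.neighborSet v).ncard = 2

/-- The number of cycles of a 2-factor, i.e. its number of connected components. -/
noncomputable def numCycles {V : Type*} (H : SimpleGraph V) : ℕ :=
  Nat.card H.ConnectedComponent

open SimpleGraph

/-- The edges joining consecutive entries of a list (without the closing edge). -/
def pathEdges {V : Type*} (l : List V) : Set (Sym2 V) :=
  {e | ∃ p a b, l[p]? = some a ∧ l[p + 1]? = some b ∧ e = s(a, b)}

/-- The list `l`, read cyclically, is a closed walk for the relation `r`. -/
def IsCyclicChain {V : Type*} (r : V → V → Prop) (l : List V) : Prop :=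
  l.IsChain r ∧ ∀ x ∈ l.getLast?, ∀ y ∈ l.head?, r x y

/-- A partition of the vertex set into cycles of `G`, each written as a list. -/
structure IsCycleCover {V : Type*} [DecidableEq V] (G : SimpleGraph V) (L : List (List V)) :
    Prop where
  three_le : ∀ l ∈ L, 3 ≤ l.length
  chain : ∀ l ∈ L, IsCyclicChain G.Adj l
  count_eq_one : ∀ v, L.flatten.count v = 1

/-- `L` can be changed into a cycle cover with one more cycle, losing at most six path edges. -/
def HasAugmentation {V : Type*} [DecidableEq V] (G : SimpleGraph V) (L : List (List V)) : Prop :=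
  ∃ (L' : List (List V)) (F : Finset (Sym2 V)), IsCycleCover G L' ∧ L'.length = L.length + 1 ∧
    F.card ≤ 6 ∧ ∀ l ∈ L, ∀ e ∈ pathEdges l, e ∈ F ∨ ∃ l' ∈ L', e ∈ pathEdges l'

section Moves

variable {V : Type*}

lemma pathEdges_append {l₁ l₂ : List V} {x y : V} (hx : l₁.getLast? = some x)
    (hy : l₂.head? = some y) :
    pathEdges (l₁ ++ l₂) = insert s(x, y) (pathEdges l₁ ∪ pathEdges l₂) := by
  have h1 : l₁ ≠ [] := by rintro rfl; simp at hx
  have h1' : 0 < l₁.length := List.length_pos_of_ne_nil h1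
  rw [List.getLast?_eq_getElem?] at hx
  rw [List.head?_eq_getElem?] at hy
  ext e
  simp only [pathEdges, Set.mem_ofPred_eq, Set.mem_insert_iff, Set.mem_union]
  constructor
  · rintro ⟨p, a, b, ha, hb, rfl⟩
    rcases lt_trichotomy (p + 1) l₁.length with h | h | h
    · rw [List.getElem?_append_left (by omega)] at ha hb
      exact .inr (.inl ⟨p, a, b, ha, hb, rfl⟩)
    · rw [List.getElem?_append_left (by omega)] at ha
      rw [List.getElem?_append_right (by omega)] at hb
      rw [show p + 1 - l₁.length = 0 by omega, hy] at hb
      rw [show l₁.length - 1 = p by omega, ha] at hx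
      simp_all
    · rw [List.getElem?_append_right (by omega)] at ha hb
      rw [show p + 1 - l₁.length = p - l₁.length + 1 by omega] at hb
      exact .inr (.inr ⟨_, a, b, ha, hb, rfl⟩)
  · rintro (rfl | ⟨p, a, b, ha, hb, rfl⟩ | ⟨p, a, b, ha, hb, rfl⟩)
    · refine ⟨l₁.length - 1, x, y, ?_, ?_, rfl⟩
      · rw [List.getElem?_append_left (by omega), hx]
      · rw [List.getElem?_append_right (by omega),
          show l₁.length - 1 + 1 - l₁.length = 0 by omega, hy]
    · obtain ⟨h, -⟩ := List.getElem?_eq_some_iff.1 ha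
      obtain ⟨h', -⟩ := List.getElem?_eq_some_iff.1 hb
      refine ⟨p, a, b, ?_, ?_, rfl⟩
      · rw [List.getElem?_append_left h, ha]
      · rw [List.getElem?_append_left h', hb]
    · refine ⟨l₁.length + p, a, b, ?_, ?_, rfl⟩
      · rw [List.getElem?_append_right (by omega), Nat.add_sub_cancel_left, ha]
      · rw [List.getElem?_append_right (by omega), add_assoc, Nat.add_sub_cancel_left, hb]

lemma pathEdges_reverse (l : List V) : pathEdges l.reverse = pathEdges l := by
  have key : ∀ l : List V, pathEdges l ⊆ pathEdges l.reverse := by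
    rintro l e ⟨p, a, b, ha, hb, rfl⟩
    obtain ⟨h, -⟩ := List.getElem?_eq_some_iff.1 hb
    refine ⟨l.length - 2 - p, b, a, ?_, ?_, Sym2.eq_swap⟩
    · rw [List.getElem?_reverse (by omega), ← hb]; congr 1; omega
    · rw [List.getElem?_reverse (by omega), ← ha]; congr 1; omega
  exact Set.Subset.antisymm (by simpa using key l.reverse) (key l)

lemma IsCyclicChain.reverse {G : SimpleGraph V} {l : List V} (h : IsCyclicChain G.Adj l) :
    IsCyclicChain G.Adj l.reverse := by
  refine ⟨?_, fun x hx y hy => ?_⟩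
  · rw [List.isChain_reverse]
    simpa only [G.adj_comm] using h.1
  · rw [List.getLast?_reverse] at hx
    rw [List.head?_reverse] at hy
    exact (h.2 y hy x hx).symm

variable [DecidableEq V] {G : SimpleGraph V}

lemma IsCycleCover.perm {L L' : List (List V)} (h : IsCycleCover G L) (hp : L.Perm L') :
    IsCycleCover G L' where
  three_le l hl := h.three_le l (hp.mem_iff.2 hl)
  chain l hl := h.chain l (hp.mem_iff.2 hl)
  count_eq_one v := by rw [← hp.flatten.count_eq, h.count_eq_one]

/-- Replace some cycles of a cover by other cycles on the same vertices. -/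
lemma IsCycleCover.hasAugmentation_of_replace {L Old New M : List (List V)}
    (h : IsCycleCover G L) (hp : L.Perm (Old ++ M)) (F : Finset (Sym2 V)) (hF : F.card ≤ 6)
    (hlen : New.length = Old.length + 1)
    (hcount : ∀ v, New.flatten.count v = Old.flatten.count v)
    (hNew : ∀ l ∈ New, 3 ≤ l.length ∧ IsCyclicChain G.Adj l)
    (hedge : ∀ l ∈ Old, ∀ e ∈ pathEdges l, e ∈ F ∨ ∃ l' ∈ New, e ∈ pathEdges l') :
    HasAugmentation G L := by
  have h' := h.perm hp
  refine ⟨New ++ M, F, ⟨fun l hl => ?_, fun l hl => ?_, fun v => ?_⟩, ?_, hF, fun l hl e he => ?_⟩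
  · rcases List.mem_append.1 hl with hl | hl
    · exact (hNew l hl).1
    · exact h'.three_le l (List.mem_append_right _ hl)
  · rcases List.mem_append.1 hl with hl | hl
    · exact (hNew l hl).2
    · exact h'.chain l (List.mem_append_right _ hl)
  · rw [← h'.count_eq_one v]
    simp [hcount]
  · rw [hp.length_eq, List.length_append, List.length_append, hlen]; omega
  · rcases List.mem_append.1 (hp.mem_iff.1 hl) with hl | hl
    · obtain he | ⟨l', hl', he⟩ := hedge l hl e he
      · exact .inl he
      · exact .inr ⟨l', List.mem_append_left _ hl', he⟩
    · exact .inr ⟨l, List.mem_append_right _ hl, he⟩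

/-- Reversing one cycle of a cover does not matter. -/
lemma HasAugmentation.of_reverse {l : List V} {M : List (List V)}
    (h : HasAugmentation G (l.reverse :: M)) : HasAugmentation G (l :: M) := by
  obtain ⟨L', F, h1, h2, h3, h4⟩ := h
  refine ⟨L', F, h1, by simpa using h2, h3, fun l' hl' e he => ?_⟩
  rcases List.mem_cons.1 hl' with rfl | hl'
  · exact h4 l'.reverse (by simp) e (by rwa [pathEdges_reverse])
  · exact h4 l' (by simp [hl']) e he

lemma HasAugmentation.perm {L L' : List (List V)} (h : HasAugmentation G L) (hp : L.Perm L') :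
    HasAugmentation G L' := by
  obtain ⟨L', F, h1, h2, h3, h4⟩ := h
  exact ⟨L', F, h1, by rw [h2, hp.length_eq], h3, fun l hl => h4 l (hp.mem_iff.2 hl)⟩

/-- Splitting a cycle along two parallel chords. -/
lemma hasAugmentation_of_parallel {A B D : List V} {M : List (List V)} {a x y z w d : V}
    (h : IsCycleCover G ((A ++ B ++ D) :: M))
    (hA : A.head? = some a) (hA' : A.getLast? = some x)
    (hB : B.head? = some y) (hB' : B.getLast? = some z)
    (hD : D.head? = some w) (hD' : D.getLast? = some d)
    (hlB : 3 ≤ B.length) (hlA : 3 ≤ A.length + D.length)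
    (hyz : G.Adj y z) (hxw : G.Adj x w) : HasAugmentation G ((A ++ B ++ D) :: M) := by
  have hc := h.chain _ List.mem_cons_self
  simp only [IsCyclicChain, List.isChain_append, List.getLast?_append, List.head?_append, *,
    Option.some_or, Option.mem_some_iff, forall_eq'] at hc
  refine h.hasAugmentation_of_replace (Old := [A ++ B ++ D]) (New := [B, A ++ D]) (M := M) (by simp)
    {s(x, y), s(z, w)} (Finset.card_le_two.trans (by norm_num)) (by simp) (fun v => ?_) ?_ ?_
  · simp only [List.flatten_cons, List.flatten_nil, List.count_append, List.count_nil]; omega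
  · simp only [List.mem_cons, List.not_mem_nil, or_false, forall_eq_or_imp, forall_eq,
      IsCyclicChain, List.isChain_append, List.getLast?_append, List.head?_append, *,
      Option.some_or, Option.mem_some_iff, forall_eq', List.length_append, hyz.symm]
    tauto
  · simp only [forall_eq, List.mem_cons, List.not_mem_nil, or_false,
      exists_eq_or_imp, exists_eq_left, Finset.mem_insert, Finset.mem_singleton]
    rw [pathEdges_append (x := z) (y := w) (by simp [*]) (by simp [*]),
      pathEdges_append (x := x) (y := y) (by simp [*]) (by simp [*]),
      pathEdges_append (x := x) (y := w) (by simp [*]) (by simp [*])]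
    simp only [Set.mem_insert_iff, Set.mem_union]
    tauto

/-- Splitting a cycle along two pairs of crossing chords. -/
lemma hasAugmentation_of_crossing {A P₁ P₂ P₃ D : List V} {M : List (List V)}
    {a x₁ y₁ x₂ y₂ w₁ z₁ w₂ z₂ d : V}
    (h : IsCycleCover G ((A ++ P₁ ++ P₂ ++ P₃ ++ D) :: M))
    (hA : A.head? = some a) (hA' : A.getLast? = some x₁)
    (h1 : P₁.head? = some y₁) (h1' : P₁.getLast? = some x₂)
    (h2 : P₂.head? = some y₂) (h2' : P₂.getLast? = some w₁)
    (h3 : P₃.head? = some z₁) (h3' : P₃.getLast? = some w₂)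
    (hD : D.head? = some z₂) (hD' : D.getLast? = some d)
    (hl1 : 3 ≤ P₁.length + P₃.length) (hl2 : 3 ≤ P₂.length + (D.length + A.length))
    (hxw₁ : G.Adj x₁ w₁) (hyz₁ : G.Adj y₁ z₁) (hxw₂ : G.Adj x₂ w₂) (hyz₂ : G.Adj y₂ z₂) :
    HasAugmentation G ((A ++ P₁ ++ P₂ ++ P₃ ++ D) :: M) := by
  have hc := h.chain _ List.mem_cons_self
  simp only [IsCyclicChain, List.isChain_append, List.getLast?_append, List.head?_append, *,
    Option.some_or, Option.mem_some_iff, forall_eq'] at hc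
  refine h.hasAugmentation_of_replace (Old := [A ++ P₁ ++ P₂ ++ P₃ ++ D])
    (New := [P₁ ++ P₃.reverse, P₂ ++ (D ++ A).reverse]) (M := M) (by simp)
    {s(x₁, y₁), s(x₂, y₂), s(w₁, z₁), s(w₂, z₂)} (Finset.card_le_four.trans (by norm_num))
    (by simp) (fun v => ?_) ?_ ?_
  · simp only [List.flatten_cons, List.flatten_nil, List.count_append, List.count_nil,
      List.count_reverse]; omega
  · simp only [List.mem_cons, List.not_mem_nil, or_false, forall_eq_or_imp, forall_eq,
      IsCyclicChain, List.isChain_append, List.getLast?_append, List.head?_append, *,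
      List.isChain_reverse, List.getLast?_reverse, List.head?_reverse,
      Option.some_or, Option.mem_some_iff, forall_eq', List.length_append, List.length_reverse]
    simp only [G.adj_comm] at *
    tauto
  · simp only [forall_eq, List.mem_cons, List.not_mem_nil, or_false,
      exists_eq_or_imp, exists_eq_left, Finset.mem_insert, Finset.mem_singleton]
    rw [pathEdges_append (x := w₂) (y := z₂) (by simp [*]) (by simp [*]),
      pathEdges_append (x := w₁) (y := z₁) (by simp [*]) (by simp [*]),
      pathEdges_append (x := x₂) (y := y₂) (by simp [*]) (by simp [*]),
      pathEdges_append (x := x₁) (y := y₁) (by simp [*]) (by simp [*]),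
      pathEdges_append (x := x₂) (y := w₂) (by simp [*]) (by simp [*]),
      pathEdges_append (x := w₁) (y := x₁) (by simp [*]) (by simp [*]),
      pathEdges_reverse, pathEdges_reverse,
      pathEdges_append (x := d) (y := a) (by simp [*]) (by simp [*])]
    simp only [Set.mem_insert_iff, Set.mem_union]
    tauto

/-- Turning two cycles into three using three disjoint pairs of parallel rungs between them. -/
lemma hasAugmentation_of_rungs {A P₁ P₂ D A' Q₁ Q₂ D' : List V} {M : List (List V)}
    {a x₁ y₁ x₂ y₂ x₃ y₃ d a' z₁ w₁ z₂ w₂ z₃ w₃ d' : V}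
    (h : IsCycleCover G ((A ++ P₁ ++ P₂ ++ D) :: (A' ++ Q₁ ++ Q₂ ++ D') :: M))
    (hA : A.head? = some a) (hA' : A.getLast? = some x₁)
    (h1 : P₁.head? = some y₁) (h1' : P₁.getLast? = some x₂)
    (h2 : P₂.head? = some y₂) (h2' : P₂.getLast? = some x₃)
    (hD : D.head? = some y₃) (hD' : D.getLast? = some d)
    (kA : A'.head? = some a') (kA' : A'.getLast? = some z₁)
    (k1 : Q₁.head? = some w₁) (k1' : Q₁.getLast? = some z₂)
    (k2 : Q₂.head? = some w₂) (k2' : Q₂.getLast? = some z₃)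
    (kD : D'.head? = some w₃) (kD' : D'.getLast? = some d')
    (hl1 : 3 ≤ P₁.length + Q₁.length) (hl2 : 3 ≤ P₂.length + Q₂.length)
    (hl3 : 3 ≤ D.length + A.length + (D'.length + A'.length))
    (hxz₁ : G.Adj x₁ z₁) (hyw₁ : G.Adj y₁ w₁) (hxz₂ : G.Adj x₂ z₂) (hyw₂ : G.Adj y₂ w₂)
    (hxz₃ : G.Adj x₃ z₃) (hyw₃ : G.Adj y₃ w₃) :
    HasAugmentation G ((A ++ P₁ ++ P₂ ++ D) :: (A' ++ Q₁ ++ Q₂ ++ D') :: M) := by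
  have hc := h.chain _ List.mem_cons_self
  have hc' := h.chain _ (List.mem_cons_of_mem _ List.mem_cons_self)
  simp only [IsCyclicChain, List.isChain_append, List.getLast?_append, List.head?_append, *,
    Option.some_or, Option.mem_some_iff, forall_eq'] at hc hc'
  refine h.hasAugmentation_of_replace
    (Old := [A ++ P₁ ++ P₂ ++ D, A' ++ Q₁ ++ Q₂ ++ D'])
    (New := [P₁ ++ Q₁.reverse, P₂ ++ Q₂.reverse, (D ++ A) ++ (D' ++ A').reverse])
    (M := M) (by simp)
    {s(x₁, y₁), s(x₂, y₂), s(x₃, y₃), s(z₁, w₁), s(z₂, w₂), s(z₃, w₃)} Finset.card_le_six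
    (by simp) (fun v => ?_) ?_ ?_
  · simp only [List.flatten_cons, List.flatten_nil, List.count_append, List.count_nil,
      List.count_reverse]; omega
  · simp only [List.mem_cons, List.not_mem_nil, or_false, forall_eq_or_imp, forall_eq,
      IsCyclicChain, List.isChain_append, List.getLast?_append, List.head?_append, *,
      List.isChain_reverse, List.getLast?_reverse, List.head?_reverse,
      Option.some_or, Option.mem_some_iff, forall_eq', List.length_append, List.length_reverse]
    simp only [G.adj_comm] at *
    tauto
  · simp only [forall_eq, List.mem_cons, List.not_mem_nil, or_false, forall_eq_or_imp,
      exists_eq_or_imp, exists_eq_left, Finset.mem_insert, Finset.mem_singleton]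
    rw [pathEdges_append (l₁ := A ++ P₁ ++ P₂) (x := x₃) (y := y₃) (by simp [*]) (by simp [*]),
      pathEdges_append (l₁ := A ++ P₁) (x := x₂) (y := y₂) (by simp [*]) (by simp [*]),
      pathEdges_append (l₁ := A) (l₂ := P₁) (x := x₁) (y := y₁) (by simp [*]) (by simp [*]),
      pathEdges_append (l₁ := A' ++ Q₁ ++ Q₂) (x := z₃) (y := w₃) (by simp [*]) (by simp [*]),
      pathEdges_append (l₁ := A' ++ Q₁) (x := z₂) (y := w₂) (by simp [*]) (by simp [*]),
      pathEdges_append (l₁ := A') (l₂ := Q₁) (x := z₁) (y := w₁) (by simp [*]) (by simp [*]),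
      pathEdges_append (l₁ := P₁) (x := x₂) (y := z₂) (by simp [*]) (by simp [*]),
      pathEdges_append (l₁ := P₂) (x := x₃) (y := z₃) (by simp [*]) (by simp [*]),
      pathEdges_append (l₁ := D ++ A) (x := x₁) (y := z₁) (by simp [*]) (by simp [*]),
      pathEdges_reverse, pathEdges_reverse, pathEdges_reverse,
      pathEdges_append (l₁ := D) (x := d) (y := a) (by simp [*]) (by simp [*]),
      pathEdges_append (l₁ := D') (x := d') (y := a') (by simp [*]) (by simp [*])]
    simp only [Set.mem_insert_iff, Set.mem_union]
    refine ⟨fun e he => ?_, fun e he => ?_⟩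
    · rcases he with he | (he | (he | he | he) | he) | he <;> simp only [he, true_or, or_true]
    · rcases he with he | (he | (he | he | he) | he) | he <;> simp only [he, true_or, or_true]

end Moves

section Counting

lemma card_le_of_forall_no_crossing {S : Finset (ℕ × ℕ)} {a : ℕ}
    (hS : ∀ c ∈ S, c.1 < a ∧ c.2 < a)
    (h : ∀ p p' q q', (p', q) ∈ S → (p, q) ∈ S → (p, q') ∈ S → p' + 2 ≤ p → q < q' → False) :
    S.card ≤ 3 * a := by
  classical
  set B₁ := S.filter fun c => ∀ p', (p', c.2) ∈ S → c.1 < p' + 2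
  set B₂ := S.filter fun c => ∀ q', (c.1, q') ∈ S → q' ≤ c.2
  have hcov : S ⊆ B₁ ∪ B₂ := by
    rintro ⟨p, q⟩ hc
    by_contra hn
    simp only [B₁, B₂, Finset.mem_union, Finset.mem_filter, hc, true_and, not_or, not_forall,
      not_lt, not_le] at hn
    obtain ⟨⟨p', h1, h2⟩, q', h3, h4⟩ := hn
    exact h p p' q q' h1 hc h3 h2 h4
  have h1 : B₁.card ≤ (Finset.range a ×ˢ Finset.range 2).card := by
    refine Finset.card_le_card_of_injOn (fun c => (c.2, c.1 % 2)) ?_ ?_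
    · rintro ⟨p, q⟩ hc
      have := hS _ (Finset.mem_filter.1 hc).1
      simp only [Finset.coe_product, Finset.coe_range, Set.mem_prod, Set.mem_Iio]
      exact ⟨this.2, Nat.mod_lt _ two_pos⟩
    · rintro ⟨p, q⟩ hc ⟨p', q'⟩ hc' heq
      obtain ⟨rfl, hp⟩ := Prod.mk.inj heq
      have e1 := (Finset.mem_filter.1 hc).2 p' (Finset.mem_filter.1 hc').1
      have e2 := (Finset.mem_filter.1 hc').2 p (Finset.mem_filter.1 hc).1
      dsimp only at e1 e2 hp
      congr 1; omega
  have h2 : B₂.card ≤ (Finset.range a).card := by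
    refine Finset.card_le_card_of_injOn Prod.fst ?_ ?_
    · rintro ⟨p, q⟩ hc
      simpa using (hS _ (Finset.mem_filter.1 hc).1).1
    · rintro ⟨p, q⟩ hc ⟨p', q'⟩ hc' heq
      obtain rfl : p = p' := heq
      have e1 := (Finset.mem_filter.1 hc).2 q' (Finset.mem_filter.1 hc').1
      have e2 := (Finset.mem_filter.1 hc').2 q (Finset.mem_filter.1 hc).1
      dsimp only at e1 e2
      congr 1; omega
  have h3 := (Finset.card_le_card hcov).trans (Finset.card_union_le _ _)
  simp only [Finset.card_product, Finset.card_range] at h1 h2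
  omega

/-- The points of `S` with a later point of `S` to the upper right. -/
def nonMaximal (S : Finset (ℕ × ℕ)) : Finset (ℕ × ℕ) :=
  open Classical in S.filter fun c => ∃ c' ∈ S, c.1 + 2 ≤ c'.1 ∧ c.2 < c'.2

lemma card_le_card_nonMaximal_add {S : Finset (ℕ × ℕ)} {a b : ℕ}
    (hS : ∀ c ∈ S, c.1 < a ∧ c.2 < b) : S.card ≤ (nonMaximal S).card + 2 * (a + b) := by
  classical
  have h1 : (S \ nonMaximal S).card ≤ (Finset.range (a + b) ×ˢ Finset.range 2).card := by
    have hmem : ∀ c ∈ S \ nonMaximal S, c ∈ S ∧ ∀ c' ∈ S, ¬ (c.1 + 2 ≤ c'.1 ∧ c.2 < c'.2) := by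
      intro c hc
      rw [Finset.mem_sdiff] at hc
      refine ⟨hc.1, fun c' hc' h => hc.2 ?_⟩
      exact Finset.mem_filter.2 ⟨hc.1, c', hc', h⟩
    refine Finset.card_le_card_of_injOn (fun c => (c.1 + b - c.2, c.1 % 2)) ?_ ?_
    · intro c hc
      have := hS _ (hmem c hc).1
      simp only [Finset.coe_product, Finset.coe_range, Set.mem_prod, Set.mem_Iio]
      omega
    · rintro ⟨p, q⟩ hc ⟨p', q'⟩ hc' heq
      obtain ⟨c1, c2⟩ := hmem _ hc
      obtain ⟨c1', c2'⟩ := hmem _ hc'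
      obtain ⟨e1, e2⟩ := Prod.mk.inj heq
      have l1 := hS _ c1
      have l2 := hS _ c1'
      have l3 := c2 _ c1'
      have l4 := c2' _ c1
      dsimp only at *
      rw [Prod.mk.injEq]
      omega
  have h2 := Finset.le_card_sdiff (nonMaximal S) S
  simp only [Finset.card_product, Finset.card_range] at h1
  omega

lemma exists_increasing_triple {S : Finset (ℕ × ℕ)} {a b : ℕ}
    (hS : ∀ c ∈ S, c.1 < a ∧ c.2 < b) (h : 4 * (a + b) < S.card) :
    ∃ c₁ ∈ S, ∃ c₂ ∈ S, ∃ c₃ ∈ S,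
      (c₁.1 + 2 ≤ c₂.1 ∧ c₁.2 < c₂.2) ∧ c₂.1 + 2 ≤ c₃.1 ∧ c₂.2 < c₃.2 := by
  classical
  have hsub : ∀ T : Finset (ℕ × ℕ), nonMaximal T ⊆ T := fun T => Finset.filter_subset _ _
  have h1 := card_le_card_nonMaximal_add hS
  have h2 := card_le_card_nonMaximal_add (S := nonMaximal S) fun c hc => hS c (hsub _ hc)
  have h3 : 0 < (nonMaximal (nonMaximal S)).card := by omega
  obtain ⟨c₁, hc₁⟩ := Finset.card_pos.1 h3
  obtain ⟨h11, c₂, hc₂, h12⟩ := Finset.mem_filter.1 hc₁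
  obtain ⟨h21, c₃, hc₃, h23⟩ := Finset.mem_filter.1 hc₂
  exact ⟨c₁, hsub _ h11, c₂, h21, c₃, hc₃, h12, h23⟩

end Counting

section Positions

variable {V : Type*}

/-- The edges at positions `p` of `l` and `q` of `l'` are joined start to start and
end to end. -/
def StraightRung (G : SimpleGraph V) (l l' : List V) (p q : ℕ) : Prop :=
  ∃ x y z w, l[p]? = some x ∧ l[p + 1]? = some y ∧ l'[q]? = some z ∧ l'[q + 1]? = some w ∧
    G.Adj x z ∧ G.Adj y w

/-- The edges at positions `p` of `l` and `q` of `l'` are joined start to end and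
end to start. -/
def TwistedRung (G : SimpleGraph V) (l l' : List V) (p q : ℕ) : Prop :=
  ∃ x y z w, l[p]? = some x ∧ l[p + 1]? = some y ∧ l'[q]? = some z ∧ l'[q + 1]? = some w ∧
    G.Adj x w ∧ G.Adj y z

lemma StraightRung.lt {G : SimpleGraph V} {l l' : List V} {p q : ℕ}
    (h : StraightRung G l l' p q) : p + 1 < l.length ∧ q + 1 < l'.length := by
  obtain ⟨x, y, z, w, -, h1, -, h2, -⟩ := h
  exact ⟨(List.getElem?_eq_some_iff.1 h1).1, (List.getElem?_eq_some_iff.1 h2).1⟩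

lemma TwistedRung.lt {G : SimpleGraph V} {l l' : List V} {p q : ℕ}
    (h : TwistedRung G l l' p q) : p + 1 < l.length ∧ q + 1 < l'.length := by
  obtain ⟨x, y, z, w, -, h1, -, h2, -⟩ := h
  exact ⟨(List.getElem?_eq_some_iff.1 h1).1, (List.getElem?_eq_some_iff.1 h2).1⟩

lemma TwistedRung.straightRung_reverse {G : SimpleGraph V} {l l' : List V} {p q : ℕ}
    (h : TwistedRung G l l' p q) : StraightRung G l l'.reverse p (l'.length - 2 - q) := by
  have hlt := h.lt.2
  obtain ⟨x, y, z, w, h1, h2, h3, h4, h5, h6⟩ := h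
  refine ⟨x, y, w, z, h1, h2, ?_, ?_, h5, h6⟩
  · rw [List.getElem?_reverse (by omega), ← h4]; congr 1; omega
  · rw [List.getElem?_reverse (by omega), ← h3]; congr 1; omega

/-- The entries of `l` at positions `i, …, j - 1`. -/
def listSlice (l : List V) (i j : ℕ) : List V := (l.drop i).take (j - i)

lemma listSlice_append (l : List V) {i j k : ℕ} (hij : i ≤ j) (hjk : j ≤ k) :
    listSlice l i j ++ listSlice l j k = listSlice l i k := by
  unfold listSlice
  rw [show k - i = (j - i) + (k - j) by omega, List.take_add, List.drop_drop,
    show i + (j - i) = j by omega]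

lemma listSlice_zero_length (l : List V) : listSlice l 0 l.length = l := by
  simp [listSlice]

lemma length_listSlice {l : List V} {i j : ℕ} (hj : j ≤ l.length) :
    (listSlice l i j).length = j - i := by
  simp only [listSlice, List.length_take, List.length_drop]; omega

lemma head?_listSlice {l : List V} {i j : ℕ} {v : V} (hij : i < j) (h : l[i]? = some v) :
    (listSlice l i j).head? = some v := by
  rw [listSlice, List.head?_take, if_neg (by omega), List.head?_drop, h]

lemma getLast?_listSlice {l : List V} {i j : ℕ} {v : V} (hij : i ≤ j)
    (h : l[j]? = some v) : (listSlice l i (j + 1)).getLast? = some v := by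
  rw [listSlice, List.getLast?_take, if_neg (by omega), List.getElem?_drop,
    show i + (j + 1 - i - 1) = j by omega, h, Option.some_or]

variable [DecidableEq V] {G : SimpleGraph V}

lemma TwistedRung.hasAugmentation {l : List V} {M : List (List V)} {p q : ℕ}
    (hr : TwistedRung G l l p q) (h : IsCycleCover G (l :: M)) (hp : 1 ≤ p) (hpq : p + 3 ≤ q) :
    HasAugmentation G (l :: M) := by
  have hlt := hr.lt.2
  obtain ⟨x, y, z, w, h1, h2, h3, h4, h5, h6⟩ := hr
  obtain ⟨a, ha⟩ : ∃ a, l[0]? = some a := ⟨l[0], List.getElem?_eq_getElem _⟩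
  obtain ⟨n, hn⟩ : ∃ n, l.length = n + 1 := ⟨l.length - 1, by omega⟩
  obtain ⟨d, hd⟩ : ∃ d, l[n]? = some d := ⟨l[n], List.getElem?_eq_getElem _⟩
  have hl : l = listSlice l 0 (p + 1) ++ listSlice l (p + 1) (q + 1) ++
      listSlice l (q + 1) (n + 1) := by
    rw [listSlice_append _ (by omega) (by omega), listSlice_append _ (by omega) (by omega), ← hn,
      listSlice_zero_length]
  rw [hl] at h ⊢
  refine hasAugmentation_of_parallel h (head?_listSlice (by omega) ha)
    (getLast?_listSlice (by omega) h1) (head?_listSlice (by omega) h2)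
    (getLast?_listSlice (by omega) h3) (head?_listSlice (by omega) h4)
    (getLast?_listSlice (by omega) hd) ?_ ?_ h6 h5
  all_goals repeat rw [length_listSlice (by omega)]
  all_goals omega

lemma hasAugmentation_of_straightRung_crossing {l : List V} {M : List (List V)} {p₁ q₁ p₂ q₂ : ℕ}
    (h : IsCycleCover G (l :: M)) (hr₁ : StraightRung G l l p₁ q₁)
    (hr₂ : StraightRung G l l p₂ q₂) (hp : p₁ + 2 ≤ p₂) (hpq : p₂ < q₁) (hq : q₁ < q₂) :
    HasAugmentation G (l :: M) := by
  have hlt := hr₂.lt.2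
  obtain ⟨x₁, y₁, w₁, z₁, h1, h2, h3, h4, h5, h6⟩ := hr₁
  obtain ⟨x₂, y₂, w₂, z₂, k1, k2, k3, k4, k5, k6⟩ := hr₂
  obtain ⟨a, ha⟩ : ∃ a, l[0]? = some a := ⟨l[0], List.getElem?_eq_getElem _⟩
  obtain ⟨n, hn⟩ : ∃ n, l.length = n + 1 := ⟨l.length - 1, by omega⟩
  obtain ⟨d, hd⟩ : ∃ d, l[n]? = some d := ⟨l[n], List.getElem?_eq_getElem _⟩
  have hl : l = listSlice l 0 (p₁ + 1) ++ listSlice l (p₁ + 1) (p₂ + 1) ++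
      listSlice l (p₂ + 1) (q₁ + 1) ++ listSlice l (q₁ + 1) (q₂ + 1) ++
      listSlice l (q₂ + 1) (n + 1) := by
    repeat rw [listSlice_append _ (by omega) (by omega)]
    rw [← hn, listSlice_zero_length]
  rw [hl] at h ⊢
  refine hasAugmentation_of_crossing h (head?_listSlice (by omega) ha)
    (getLast?_listSlice (by omega) h1) (head?_listSlice (by omega) h2)
    (getLast?_listSlice (by omega) k1) (head?_listSlice (by omega) k2)
    (getLast?_listSlice (by omega) h3) (head?_listSlice (by omega) h4)
    (getLast?_listSlice (by omega) k3) (head?_listSlice (by omega) k4)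
    (getLast?_listSlice (by omega) hd) ?_ ?_ h5 h6 k5 k6
  all_goals repeat rw [length_listSlice (by omega)]
  all_goals omega

lemma hasAugmentation_of_three_straightRungs {l l' : List V} {M : List (List V)}
    {p₁ q₁ p₂ q₂ p₃ q₃ : ℕ} (h : IsCycleCover G (l :: l' :: M))
    (hr₁ : StraightRung G l l' p₁ q₁) (hr₂ : StraightRung G l l' p₂ q₂)
    (hr₃ : StraightRung G l l' p₃ q₃) (hp₁ : p₁ + 2 ≤ p₂) (hq₁ : q₁ < q₂)
    (hp₂ : p₂ + 2 ≤ p₃) (hq₂ : q₂ < q₃) : HasAugmentation G (l :: l' :: M) := by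
  have hlt := hr₃.lt
  obtain ⟨x₁, y₁, z₁, w₁, h1, h2, h3, h4, h5, h6⟩ := hr₁
  obtain ⟨x₂, y₂, z₂, w₂, k1, k2, k3, k4, k5, k6⟩ := hr₂
  obtain ⟨x₃, y₃, z₃, w₃, m1, m2, m3, m4, m5, m6⟩ := hr₃
  obtain ⟨a, ha⟩ : ∃ a, l[0]? = some a := ⟨l[0], List.getElem?_eq_getElem _⟩
  obtain ⟨n, hn⟩ : ∃ n, l.length = n + 1 := ⟨l.length - 1, by omega⟩
  obtain ⟨d, hd⟩ : ∃ d, l[n]? = some d := ⟨l[n], List.getElem?_eq_getElem _⟩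
  obtain ⟨a', ha'⟩ : ∃ a, l'[0]? = some a := ⟨l'[0], List.getElem?_eq_getElem _⟩
  obtain ⟨n', hn'⟩ : ∃ n, l'.length = n + 1 := ⟨l'.length - 1, by omega⟩
  obtain ⟨d', hd'⟩ : ∃ d, l'[n']? = some d := ⟨l'[n'], List.getElem?_eq_getElem _⟩
  have hl : l = listSlice l 0 (p₁ + 1) ++ listSlice l (p₁ + 1) (p₂ + 1) ++
      listSlice l (p₂ + 1) (p₃ + 1) ++ listSlice l (p₃ + 1) (n + 1) := by
    repeat rw [listSlice_append _ (by omega) (by omega)]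
    rw [← hn, listSlice_zero_length]
  have hl' : l' = listSlice l' 0 (q₁ + 1) ++ listSlice l' (q₁ + 1) (q₂ + 1) ++
      listSlice l' (q₂ + 1) (q₃ + 1) ++ listSlice l' (q₃ + 1) (n' + 1) := by
    repeat rw [listSlice_append _ (by omega) (by omega)]
    rw [← hn', listSlice_zero_length]
  rw [hl, hl'] at h ⊢
  refine hasAugmentation_of_rungs h (head?_listSlice (by omega) ha)
    (getLast?_listSlice (by omega) h1) (head?_listSlice (by omega) h2)
    (getLast?_listSlice (by omega) k1) (head?_listSlice (by omega) k2)
    (getLast?_listSlice (by omega) m1) (head?_listSlice (by omega) m2)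
    (getLast?_listSlice (by omega) hd) (head?_listSlice (by omega) ha')
    (getLast?_listSlice (by omega) h3) (head?_listSlice (by omega) h4)
    (getLast?_listSlice (by omega) k3) (head?_listSlice (by omega) k4)
    (getLast?_listSlice (by omega) m3) (head?_listSlice (by omega) m4)
    (getLast?_listSlice (by omega) hd') ?_ ?_ ?_ h5 h6 k5 k6 m5 m6
  all_goals repeat rw [length_listSlice (by omega)]
  all_goals omega

end Positions

section Augmentation

variable {V : Type*}

lemma StraightRung.symm {G : SimpleGraph V} {l l' : List V} {p q : ℕ}
    (h : StraightRung G l l' p q) : StraightRung G l' l q p := by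
  obtain ⟨x, y, z, w, h1, h2, h3, h4, h5, h6⟩ := h
  exact ⟨z, w, x, y, h3, h4, h1, h2, h5.symm, h6.symm⟩

lemma TwistedRung.symm {G : SimpleGraph V} {l l' : List V} {p q : ℕ}
    (h : TwistedRung G l l' p q) : TwistedRung G l' l q p := by
  obtain ⟨x, y, z, w, h1, h2, h3, h4, h5, h6⟩ := h
  exact ⟨z, w, x, y, h3, h4, h1, h2, h6.symm, h5.symm⟩

open Classical in
/-- The positions of pairs of edges, one in `l` and one in `l'`, joined by a rung; each pair
is listed once when `l = l'`. -/
noncomputable def rungPositions (G : SimpleGraph V) (l l' : List V) : Finset (ℕ × ℕ) :=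
  (Finset.range l.length ×ˢ Finset.range l'.length).filter fun c =>
    (l = l' → c.1 < c.2) ∧ (StraightRung G l l' c.1 c.2 ∨ TwistedRung G l l' c.1 c.2)

lemma mem_rungPositions {G : SimpleGraph V} {l l' : List V} {c : ℕ × ℕ} :
    c ∈ rungPositions G l l' ↔ (c.1 < l.length ∧ c.2 < l'.length) ∧
      (l = l' → c.1 < c.2) ∧ (StraightRung G l l' c.1 c.2 ∨ TwistedRung G l l' c.1 c.2) := by
  simp [rungPositions]

variable [DecidableEq V] {G : SimpleGraph V}

lemma card_filter_twistedRung_self_le {l : List V} {M : List (List V)}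
    (h : IsCycleCover G (l :: M)) (hno : ¬ HasAugmentation G (l :: M)) {S : Finset (ℕ × ℕ)}
    (hS : ∀ c ∈ S, c.1 < c.2 ∧ TwistedRung G l l c.1 c.2) : S.card ≤ 3 * l.length := by
  have hmem : ∀ c ∈ S, c.1 < c.2 ∧ c.2 < l.length ∧ (c.1 = 0 ∨ c.2 < c.1 + 3) := by
    intro c hc
    obtain ⟨h1, h2⟩ := hS c hc
    refine ⟨h1, by have := h2.lt.2; omega, ?_⟩
    by_contra hcon
    exact hno (h2.hasAugmentation h (by omega) (by omega))
  have hle : S.card ≤ (Finset.range l.length ×ˢ Finset.range 3).card := by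
    refine Finset.card_le_card_of_injOn
      (fun c => (c.2, if c.1 = 0 then 0 else c.2 - c.1)) ?_ ?_
    · intro c hc
      have := hmem c hc
      simp only [Finset.coe_product, Finset.coe_range, Set.mem_prod, Set.mem_Iio]
      split_ifs <;> omega
    · rintro ⟨p, q⟩ hc ⟨p', q'⟩ hc' heq
      have c1 := hmem _ hc
      have c2 := hmem _ hc'
      obtain ⟨e1, e2⟩ := Prod.mk.inj heq
      dsimp only at *
      rw [Prod.mk.injEq]
      split_ifs at e2 <;> omega
  simp only [Finset.card_product, Finset.card_range] at hle
  omega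

lemma card_filter_straightRung_self_le {l : List V} {M : List (List V)}
    (h : IsCycleCover G (l :: M)) (hno : ¬ HasAugmentation G (l :: M)) {S : Finset (ℕ × ℕ)}
    (hS : ∀ c ∈ S, c.1 < c.2 ∧ StraightRung G l l c.1 c.2) : S.card ≤ 3 * l.length := by
  refine card_le_of_forall_no_crossing (fun c hc => ?_) ?_
  · have := (hS c hc).2.lt
    omega
  · intro p p' q q' h1 h2 h3 h4 h5
    exact hno (hasAugmentation_of_straightRung_crossing h (hS _ h1).2 (hS _ h3).2 h4
      (hS _ h2).1 h5)

lemma card_filter_straightRung_le {l l' : List V} {M : List (List V)}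
    (h : IsCycleCover G (l :: l' :: M)) (hno : ¬ HasAugmentation G (l :: l' :: M))
    {S : Finset (ℕ × ℕ)} (hS : ∀ c ∈ S, StraightRung G l l' c.1 c.2) :
    S.card ≤ 4 * (l.length + l'.length) := by
  by_contra! hlt
  obtain ⟨c₁, h1, c₂, h2, c₃, h3, ⟨h4, h5⟩, h6, h7⟩ := exists_increasing_triple (fun c hc => by
    have := (hS c hc).lt
    omega) hlt
  exact hno (hasAugmentation_of_three_straightRungs h (hS _ h1) (hS _ h2) (hS _ h3) h4 h5 h6 h7)

lemma IsCycleCover.reverse_second {l l' : List V} {M : List (List V)}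
    (h : IsCycleCover G (l :: l' :: M)) : IsCycleCover G (l :: l'.reverse :: M) where
  three_le := by
    have := h.three_le
    simp only [List.mem_cons, forall_eq_or_imp, List.length_reverse] at this ⊢
    exact this
  chain := by
    have := h.chain
    simp only [List.mem_cons, forall_eq_or_imp] at this ⊢
    exact ⟨this.1, this.2.1.reverse, this.2.2⟩
  count_eq_one v := by
    rw [← h.count_eq_one v]
    simp

lemma card_filter_twistedRung_le {l l' : List V} {M : List (List V)}
    (h : IsCycleCover G (l :: l' :: M)) (hno : ¬ HasAugmentation G (l :: l' :: M))
    {S : Finset (ℕ × ℕ)} (hS : ∀ c ∈ S, TwistedRung G l l' c.1 c.2) :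
    S.card ≤ 4 * (l.length + l'.length) := by
  have hno' : ¬ HasAugmentation G (l :: l'.reverse :: M) := fun hA =>
    hno ((hA.perm (List.Perm.swap _ _ _)).of_reverse.perm (List.Perm.swap _ _ _))
  have hinj : Set.InjOn (fun c : ℕ × ℕ => (c.1, l'.length - 2 - c.2)) S := by
    rintro ⟨p, q⟩ hc ⟨p', q'⟩ hc' heq
    have c1 := (hS _ hc).lt
    have c2 := (hS _ hc').lt
    obtain ⟨e1, e2⟩ := Prod.mk.inj heq
    dsimp only at *
    rw [Prod.mk.injEq]
    omega
  rw [← Finset.card_image_of_injOn hinj]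
  have := card_filter_straightRung_le h.reverse_second hno'
    (S := S.image fun c => (c.1, l'.length - 2 - c.2)) (by
      intro c hc
      obtain ⟨c', hc', rfl⟩ := Finset.mem_image.1 hc
      exact (hS c' hc').straightRung_reverse)
  simpa using this

lemma IsCycleCover.card_rungPositions_le {L : List (List V)} (h : IsCycleCover G L)
    (hno : ¬ HasAugmentation G L) {l l' : List V} (hl : l ∈ L) (hl' : l' ∈ L) :
    (rungPositions G l l').card ≤ 8 * (l.length + l'.length) := by
  classical
  set S := (rungPositions G l l').filter fun c => StraightRung G l l' c.1 c.2
  set T := (rungPositions G l l').filter fun c => TwistedRung G l l' c.1 c.2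
  have hcov : rungPositions G l l' ⊆ S ∪ T := by
    intro c hc
    have := (mem_rungPositions.1 hc).2.2
    simp only [S, T, Finset.mem_union, Finset.mem_filter]
    tauto
  have hS : ∀ c ∈ S, (l = l' → c.1 < c.2) ∧ StraightRung G l l' c.1 c.2 := fun c hc =>
    ⟨(mem_rungPositions.1 (Finset.mem_filter.1 hc).1).2.1, (Finset.mem_filter.1 hc).2⟩
  have hT : ∀ c ∈ T, (l = l' → c.1 < c.2) ∧ TwistedRung G l l' c.1 c.2 := fun c hc =>
    ⟨(mem_rungPositions.1 (Finset.mem_filter.1 hc).1).2.1, (Finset.mem_filter.1 hc).2⟩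
  have hcard := (Finset.card_le_card hcov).trans (Finset.card_union_le _ _)
  by_cases hll : l = l'
  · subst hll
    have hp := List.perm_cons_erase hl
    have hno' := fun hA : HasAugmentation G (l :: L.erase l) => hno (hA.perm hp.symm)
    have h1 := card_filter_straightRung_self_le (h.perm hp) hno' fun c hc =>
      ⟨(hS c hc).1 rfl, (hS c hc).2⟩
    have h2 := card_filter_twistedRung_self_le (h.perm hp) hno' fun c hc =>
      ⟨(hT c hc).1 rfl, (hT c hc).2⟩
    omega
  · have hl'' : l' ∈ L.erase l := (List.mem_erase_of_ne (Ne.symm hll)).2 hl'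
    have hp := (List.perm_cons_erase hl).trans ((List.perm_cons_erase hl'').cons l)
    have hno' := fun hA : HasAugmentation G (l :: l' :: (L.erase l).erase l') =>
      hno (hA.perm hp.symm)
    have h1 := card_filter_straightRung_le (h.perm hp) hno' fun c hc => (hS c hc).2
    have h2 := card_filter_twistedRung_le (h.perm hp) hno' fun c hc => (hT c hc).2
    omega

lemma IsCycleCover.nodup_flatten {L : List (List V)} (h : IsCycleCover G L) :
    L.flatten.Nodup :=
  List.nodup_iff_count_le_one.2 fun v => (h.count_eq_one v).le

lemma IsCycleCover.exists_mem {L : List (List V)} (h : IsCycleCover G L) (v : V) :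
    ∃ l ∈ L, v ∈ l :=
  List.mem_flatten.1 (List.count_pos_iff.1 (by rw [h.count_eq_one]; exact one_pos))

lemma IsCycleCover.sum_length_le [Fintype V] {L : List (List V)} (h : IsCycleCover G L) :
    ∑ l ∈ L.toFinset, l.length ≤ Fintype.card V := by
  have h1 : L.flatten.length ≤ Fintype.card V := h.nodup_flatten.length_le_card
  rw [List.length_flatten, Finset.sum_list_map_count] at h1
  refine le_trans (Finset.sum_le_sum fun l hl => ?_) h1
  exact Nat.le_mul_of_pos_left _ ((@List.count_pos_iff _ instBEqOfDecidableEq _ _ _).2 (List.mem_toFinset.1 hl))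

/-- A cycle cover with many pairs of edges that span a suitable 4-cycle has an augmentation. -/
lemma IsCycleCover.hasAugmentation_of_card_lt [Fintype V] {L : List (List V)}
    (h : IsCycleCover G L) (E R : Finset (Sym2 V))
    (hE : ∀ e ∈ E, e ∈ R ∨ ∃ l ∈ L, e ∈ pathEdges l) (A : Finset (Sym2 (Sym2 V)))
    (hA : ∀ s ∈ A, ∃ e ∈ E, ∃ e' ∈ E, s = s(e, e') ∧ e ≠ e' ∧
      ∃ x y z w, e = s(x, y) ∧ e' = s(z, w) ∧ G.Adj y z ∧ G.Adj w x)
    (hcard : R.card * E.card + 16 * (L.length * Fintype.card V) < A.card) :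
    HasAugmentation G L := by
  classical
  by_contra hno
  have hpos : A.Nonempty := Finset.card_pos.1 (by omega)
  obtain ⟨v₀⟩ : Nonempty V := by
    obtain ⟨s, hs⟩ := hpos
    obtain ⟨-, -, -, -, -, -, x, -⟩ := hA s hs
    exact ⟨x⟩
  set edgeAt : List V → ℕ → Sym2 V := fun l p => s(l.getD p v₀, l.getD (p + 1) v₀) with hedgeAt
  set A₁ := (R ×ˢ E).image fun c => s(c.1, c.2)
  set A₂ := (L.toFinset ×ˢ L.toFinset).biUnion fun l =>
    (rungPositions G l.1 l.2).image fun c => s(edgeAt l.1 c.1, edgeAt l.2 c.2)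
  have hmemA₂ : ∀ l ∈ L, ∀ l' ∈ L, ∀ p q, edgeAt l p ≠ edgeAt l' q →
      StraightRung G l l' p q ∨ TwistedRung G l l' p q → s(edgeAt l p, edgeAt l' q) ∈ A₂ := by
    have key : ∀ l ∈ L, ∀ l' ∈ L, ∀ p q, (l = l' → p < q) →
        StraightRung G l l' p q ∨ TwistedRung G l l' p q → s(edgeAt l p, edgeAt l' q) ∈ A₂ := by
      intro l hl l' hl' p q hlt hr
      have hb : p + 1 < l.length ∧ q + 1 < l'.length := hr.elim (·.lt) (·.lt)
      refine Finset.mem_biUnion.2 ⟨(l, l'), by simp [hl, hl'],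
        Finset.mem_image.2 ⟨(p, q), mem_rungPositions.2 ⟨?_, hlt, hr⟩, rfl⟩⟩
      dsimp only
      omega
    intro l hl l' hl' p q hne hr
    by_cases hlt : l = l' → p < q
    · exact key l hl l' hl' p q hlt hr
    · push Not at hlt
      obtain ⟨rfl, hqp⟩ := hlt
      have hqp' : q ≠ p := by rintro rfl; exact hne rfl
      rw [Sym2.eq_swap]
      exact key l hl l hl' q p (fun _ => by omega) (hr.imp (·.symm) (·.symm))
  have hcov : A ⊆ A₁ ∪ A₂ := by
    intro s hs
    obtain ⟨e, he, e', he', rfl, hne, x, y, z, w, hxy, hzw, hyz, hwx⟩ := hA s hs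
    rw [Finset.mem_union]
    rcases hE e he with heR | ⟨l, hl, p, a, b, ha, hb, hab⟩
    · exact .inl (Finset.mem_image.2 ⟨(e, e'), by simp [heR, he'], rfl⟩)
    rcases hE e' he' with heR | ⟨l', hl', q, c, d, hc, hd, hcd⟩
    · exact .inl (Finset.mem_image.2 ⟨(e', e), by simp [heR, he], Sym2.eq_swap⟩)
    right
    have e1 : e = edgeAt l p := by
      simp [hedgeAt, hab, List.getD_eq_getElem?_getD, ha, hb]
    have e2 : e' = edgeAt l' q := by
      simp [hedgeAt, hcd, List.getD_eq_getElem?_getD, hc, hd]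
    rw [e1, e2]
    refine hmemA₂ l hl l' hl' p q (by rwa [← e1, ← e2]) ?_
    rw [hab, Sym2.eq_iff] at hxy
    rw [hcd, Sym2.eq_iff] at hzw
    rcases hxy with ⟨rfl, rfl⟩ | ⟨rfl, rfl⟩ <;> rcases hzw with ⟨rfl, rfl⟩ | ⟨rfl, rfl⟩
    · exact .inr ⟨_, _, _, _, ha, hb, hc, hd, hwx.symm, hyz⟩
    · exact .inl ⟨_, _, _, _, ha, hb, hc, hd, hwx.symm, hyz⟩
    · exact .inl ⟨_, _, _, _, ha, hb, hc, hd, hyz, hwx.symm⟩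
    · exact .inr ⟨_, _, _, _, ha, hb, hc, hd, hyz, hwx.symm⟩
  have hA₁ : A₁.card ≤ R.card * E.card :=
    Finset.card_image_le.trans (Finset.card_product _ _).le
  have hA₂ : A₂.card ≤ 16 * (L.length * Fintype.card V) := by
    calc A₂.card ≤ ∑ l ∈ L.toFinset ×ˢ L.toFinset, 8 * (l.1.length + l.2.length) := by
          refine Finset.card_biUnion_le.trans (Finset.sum_le_sum fun l hl => ?_)
          rw [Finset.mem_product, List.mem_toFinset, List.mem_toFinset] at hl
          exact Finset.card_image_le.trans (h.card_rungPositions_le hno hl.1 hl.2)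
      _ = 16 * (L.toFinset.card * ∑ l ∈ L.toFinset, l.length) := by
          rw [← Finset.mul_sum, Finset.sum_add_distrib, Finset.sum_product, Finset.sum_product]
          simp only [Finset.sum_const, smul_eq_mul, ← Finset.mul_sum]
          ring
      _ ≤ 16 * (L.length * Fintype.card V) := by
          gcongr
          · exact List.toFinset_card_le L
          · exact h.sum_length_le
  have := (Finset.card_le_card hcov).trans (Finset.card_union_le _ _)
  omega

end Augmentation

section CoverToGraph

variable {V : Type*}

/-- `b` follows `a` in one of the lists of `L`, each read cyclically. -/
def CyclicNext (L : List (List V)) (a b : V) : Prop :=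
  ∃ l ∈ L, ∃ p, l[p]? = some a ∧ l[(p + 1) % l.length]? = some b

/-- The graph whose edges join cyclically consecutive entries of the lists of `L`. -/
def cyclicGraph (L : List (List V)) : SimpleGraph V := SimpleGraph.fromRel (CyclicNext L)

lemma IsCyclicChain.adj {G : SimpleGraph V} {l : List V} (h : IsCyclicChain G.Adj l) {p : ℕ} {a b : V}
    (ha : l[p]? = some a) (hb : l[(p + 1) % l.length]? = some b) : G.Adj a b := by
  obtain ⟨hp, rfl⟩ := List.getElem?_eq_some_iff.1 ha
  obtain hlt | heq : p + 1 < l.length ∨ p + 1 = l.length := by omega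
  · rw [Nat.mod_eq_of_lt hlt] at hb
    obtain ⟨_, rfl⟩ := List.getElem?_eq_some_iff.1 hb
    exact List.isChain_iff_getElem.1 h.1 p hlt
  · rw [heq, Nat.mod_self, ← List.head?_eq_getElem?] at hb
    refine h.2 _ ?_ _ hb
    rw [List.getLast?_eq_getElem?, ← heq, Nat.add_sub_cancel]
    exact ha

variable [DecidableEq V] {G : SimpleGraph V} {L : List (List V)}

lemma IsCycleCover.eq_of_mem (h : IsCycleCover G L) {l l' : List V} (hl : l ∈ L) (hl' : l' ∈ L)
    {v : V} (hv : v ∈ l) (hv' : v ∈ l') : l = l' := by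
  by_contra hne
  have : Std.Symm (List.Disjoint (α := V)) := ⟨fun _ _ hd => hd.symm⟩
  exact (List.nodup_flatten.1 h.nodup_flatten).2.forall hl hl' hne hv hv'

lemma IsCycleCover.nodup_of_mem (h : IsCycleCover G L) {l : List V} (hl : l ∈ L) : l.Nodup :=
  (List.nodup_flatten.1 h.nodup_flatten).1 l hl

lemma IsCycleCover.cyclicNext_iff (h : IsCycleCover G L) {l : List V} (hl : l ∈ L) {p : ℕ}
    {a b : V} (ha : l[p]? = some a) :
    CyclicNext L a b ↔ l[(p + 1) % l.length]? = some b := by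
  refine ⟨?_, fun hb => ⟨l, hl, p, ha, hb⟩⟩
  rintro ⟨l', hl', q, ha', hb⟩
  obtain rfl := h.eq_of_mem hl hl' (List.mem_of_getElem? ha) (List.mem_of_getElem? ha')
  obtain ⟨hp, -⟩ := List.getElem?_eq_some_iff.1 ha
  rwa [(List.getElem?_inj hp (h.nodup_of_mem hl)).1 (ha.trans ha'.symm)]

lemma IsCycleCover.cyclicNext_iff' (h : IsCycleCover G L) {l : List V} (hl : l ∈ L) {p : ℕ}
    {a b : V} (hb : l[p]? = some b) :
    CyclicNext L a b ↔ l[(p + l.length - 1) % l.length]? = some a := by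
  obtain ⟨hp, -⟩ := List.getElem?_eq_some_iff.1 hb
  have key : ((p + l.length - 1) % l.length + 1) % l.length = p := by
    rw [Nat.mod_add_mod, show p + l.length - 1 + 1 = p + l.length by omega, Nat.add_mod_right,
      Nat.mod_eq_of_lt hp]
  constructor
  · rintro ⟨l', hl', q, ha, hb'⟩
    obtain rfl := h.eq_of_mem hl hl' (List.mem_of_getElem? hb) (List.mem_of_getElem? hb')
    obtain ⟨hq, -⟩ := List.getElem?_eq_some_iff.1 ha
    rw [(List.getElem?_inj hp (h.nodup_of_mem hl)).1 (hb.trans hb'.symm), ← ha]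
    congr 1
    obtain hlt | heq : q + 1 < l.length ∨ q + 1 = l.length := by omega
    · rw [Nat.mod_eq_of_lt hlt, show q + 1 + l.length - 1 = q + l.length by omega,
        Nat.add_mod_right, Nat.mod_eq_of_lt hq]
    · rw [heq, Nat.mod_self, Nat.mod_eq_of_lt (by omega)]
      omega
  · intro ha
    exact ⟨l, hl, _, ha, by rwa [key]⟩

lemma IsCycleCover.cyclicNext_adj (h : IsCycleCover G L) {a b : V} (hab : CyclicNext L a b) :
    G.Adj a b := by
  obtain ⟨l, hl, p, ha, hb⟩ := hab
  exact (h.chain l hl).adj ha hb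

lemma IsCycleCover.cyclicGraph_adj (h : IsCycleCover G L) {a b : V} :
    (cyclicGraph L).Adj a b ↔ CyclicNext L a b ∨ CyclicNext L b a := by
  rw [cyclicGraph, SimpleGraph.fromRel_adj, and_iff_right_iff_imp]
  rintro (hab | hab)
  · exact (h.cyclicNext_adj hab).ne
  · exact (h.cyclicNext_adj hab).ne'

lemma IsCycleCover.isTwoFactor (h : IsCycleCover G L) : IsTwoFactor G (cyclicGraph L) := by
  refine ⟨fun a b hab => ?_, fun v => ?_⟩
  · rcases h.cyclicGraph_adj.1 hab with hab | hab
    · exact h.cyclicNext_adj hab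
    · exact (h.cyclicNext_adj hab).symm
  · obtain ⟨l, hl, hv⟩ := h.exists_mem v
    obtain ⟨p, hp, hpv⟩ := List.getElem_of_mem hv
    have hpv' : l[p]? = some v := List.getElem?_eq_some_iff.2 ⟨hp, hpv⟩
    have h3 := h.three_le l hl
    have h1 : (p + 1) % l.length < l.length := Nat.mod_lt _ (by omega)
    have h2 : (p + l.length - 1) % l.length < l.length := Nat.mod_lt _ (by omega)
    rw [Set.ncard_eq_two]
    refine ⟨l[(p + 1) % l.length], l[(p + l.length - 1) % l.length], ?_, ?_⟩
    · rw [Ne, (h.nodup_of_mem hl).getElem_inj_iff]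
      intro heq
      have : (p + 1) % l.length = p + 1 ∨ p + 1 = l.length ∧ (p + 1) % l.length = 0 := by
        obtain hlt | heq : p + 1 < l.length ∨ p + 1 = l.length := by omega
        · exact .inl (Nat.mod_eq_of_lt hlt)
        · exact .inr ⟨heq, by rw [heq, Nat.mod_self]⟩
      have : p = 0 ∧ (p + l.length - 1) % l.length = l.length - 1 ∨
          0 < p ∧ (p + l.length - 1) % l.length = p - 1 := by
        rcases Nat.eq_zero_or_pos p with rfl | hpos
        · exact .inl ⟨rfl, by rw [Nat.mod_eq_of_lt (by omega)]; omega⟩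
        · refine .inr ⟨hpos, ?_⟩
          rw [show p + l.length - 1 = p - 1 + l.length by omega, Nat.add_mod_right,
            Nat.mod_eq_of_lt (by omega)]
      omega
    · ext b
      rw [SimpleGraph.mem_neighborSet, h.cyclicGraph_adj, h.cyclicNext_iff hl hpv',
        h.cyclicNext_iff' hl hpv', List.getElem?_eq_getElem h1, List.getElem?_eq_getElem h2]
      simp [eq_comm]

lemma IsCycleCover.mem_of_reachable (h : IsCycleCover G L) {a b : V}
    (hab : (cyclicGraph L).Reachable a b) {l : List V} (hl : l ∈ L) (ha : a ∈ l) : b ∈ l := by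
  obtain ⟨w⟩ := hab
  induction w with
  | nil => exact ha
  | cons hadj _ ih =>
    refine ih ?_
    rcases h.cyclicGraph_adj.1 hadj with ⟨l', hl', p, hu, hv⟩ | ⟨l', hl', p, hv, hu⟩ <;>
    · obtain rfl := h.eq_of_mem hl hl' ha (List.mem_of_getElem? hu)
      exact List.mem_of_getElem? hv

lemma IsCycleCover.reachable_getElem (h : IsCycleCover G L) {l : List V} (hl : l ∈ L) (p : ℕ)
    (hp : p < l.length) : (cyclicGraph L).Reachable (l[0]'(by omega)) l[p] := by
  induction p with
  | zero => exact SimpleGraph.Reachable.rfl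
  | succ p ih =>
    refine (ih (by omega)).trans (SimpleGraph.Adj.reachable (h.cyclicGraph_adj.2 (.inl ?_)))
    exact ⟨l, hl, p, List.getElem?_eq_getElem _,
      by rw [Nat.mod_eq_of_lt hp]; exact List.getElem?_eq_getElem _⟩

lemma IsCycleCover.numCycles_cyclicGraph (h : IsCycleCover G L) :
    numCycles (cyclicGraph L) = L.length := by
  have hpos (i : Fin L.length) : 0 < L[i].length := by
    have := h.three_le L[i] (List.getElem_mem _)
    omega
  rw [numCycles, ← Nat.card_fin L.length]
  refine (Nat.card_congr (Equiv.ofBijective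
    (fun i : Fin L.length => (cyclicGraph L).connectedComponentMk (L[i][0]'(hpos i))) ⟨?_, ?_⟩)).symm
  · intro i j hij
    have hr := SimpleGraph.ConnectedComponent.exact hij
    have hm := h.mem_of_reachable hr (List.getElem_mem i.2) (List.getElem_mem _)
    by_contra hne
    have hd := (List.nodup_flatten.1 h.nodup_flatten).2
    rw [List.pairwise_iff_getElem] at hd
    rcases lt_or_gt_of_ne (Fin.val_ne_of_ne hne) with hlt | hlt
    · exact hd i j i.2 j.2 hlt hm (List.getElem_mem _)
    · exact hd j i j.2 i.2 hlt (List.getElem_mem _) hm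
  · intro c
    induction c using SimpleGraph.ConnectedComponent.ind with
    | h v =>
      obtain ⟨l, hl, hv⟩ := h.exists_mem v
      obtain ⟨i, hi, rfl⟩ := List.getElem_of_mem hl
      obtain ⟨p, hp, rfl⟩ := List.getElem_of_mem hv
      exact ⟨⟨i, hi⟩, SimpleGraph.ConnectedComponent.sound (h.reachable_getElem hl p hp)⟩

end CoverToGraph

section GraphToCover

variable {V : Type*}

lemma IsTwoFactor.isCycles {G C : SimpleGraph V} (h : IsTwoFactor G C) : C.IsCycles :=
  fun v _ => h.2 v

lemma IsTwoFactor.exists_list [Finite V] {G C : SimpleGraph V} (h : IsTwoFactor G C)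
    (c : C.ConnectedComponent) :
    ∃ (l : List V) (e₀ : Sym2 V), 3 ≤ l.length ∧ IsCyclicChain C.Adj l ∧ l.Nodup ∧
      (∀ v, v ∈ l ↔ C.connectedComponentMk v = c) ∧
      ∀ a b, C.Adj a b → C.connectedComponentMk a = c → s(a, b) = e₀ ∨ s(a, b) ∈ pathEdges l := by
  classical
  have := Fintype.ofFinite V
  obtain ⟨v, rfl⟩ : ∃ v, C.connectedComponentMk v = c := c.exists_rep
  have hne : (C.neighborSet v).Nonempty :=
    Set.nonempty_of_ncard_ne_zero (by rw [h.2 v]; decide)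
  obtain ⟨p, hp, hverts⟩ := h.isCycles.exists_cycle_toSubgraph_verts_eq_connectedComponentSupp
    (ConnectedComponent.connectedComponentMk_mem (v := v)) hne
  have hlen : p.support.tail.length = p.length := by simp
  have hget (i : ℕ) (hi : i < p.length) : p.support.tail[i]? = some (p.getVert (i + 1)) := by
    rw [List.getElem?_tail, p.getVert_eq_support_getElem? (by omega)]
  have h3 := hp.three_le_length
  have hmem (u : V) : u ∈ p.support ↔ C.connectedComponentMk u = C.connectedComponentMk v := by
    rw [← Walk.mem_verts_toSubgraph, hverts]
    exact ConnectedComponent.mem_supp_iff _ _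
  refine ⟨p.support.tail, s(p.getVert 0, p.getVert 1), by omega,
    ⟨p.isChain_adj_support.tail, ?_⟩, hp.support_nodup, fun u => ?_, fun a b hab ha => ?_⟩
  · intro x hx y hy
    rw [List.getLast?_eq_getElem?, hlen, hget _ (by omega), Nat.sub_add_cancel (by omega),
      Walk.getVert_length, Option.mem_some_iff] at hx
    rw [List.head?_eq_getElem?, hget _ (by omega), Option.mem_some_iff] at hy
    subst hx hy
    simpa using p.adj_getVert_succ (i := 0) (by omega)
  · rw [← hmem, p.mem_support_iff]
    refine ⟨.inr, ?_⟩
    rintro (rfl | hu)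
    · exact Walk.end_mem_tail_support hp.not_nil
    · exact hu
  · rw [← hmem, ← Walk.mem_verts_toSubgraph] at ha
    rw [← hp.adj_toSubgraph_iff_of_isCycles h.isCycles ha, Walk.toSubgraph_adj_iff] at hab
    obtain ⟨i, hi, hlt⟩ := hab
    rw [← hi]
    rcases i with _ | i
    · exact .inl rfl
    · exact .inr ⟨i, _, _, hget i (by omega), hget (i + 1) hlt, rfl⟩

lemma IsTwoFactor.exists_isCycleCover [Fintype V] [DecidableEq V] {G C : SimpleGraph V}
    (h : IsTwoFactor G C) :
    ∃ (L : List (List V)) (R : Finset (Sym2 V)), IsCycleCover G L ∧ L.length = numCycles C ∧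
      R.card ≤ numCycles C ∧ ∀ e ∈ C.edgeSet, e ∈ R ∨ ∃ l ∈ L, e ∈ pathEdges l := by
  have := Fintype.ofFinite C.ConnectedComponent
  choose l e₀ h3 hchain hnodup hmem hedge using h.exists_list
  refine ⟨Finset.univ.toList.map l, Finset.univ.image e₀, ⟨?_, ?_, fun v => ?_⟩, ?_, ?_, ?_⟩
  · simpa using h3
  · simp only [List.forall_mem_map]
    exact fun c _ => ⟨(hchain c).1.imp fun _ _ hab => h.1 hab,
      fun x hx y hy => h.1 ((hchain c).2 x hx y hy)⟩
  · refine List.count_eq_one_of_mem (List.nodup_flatten.2 ⟨by simpa using hnodup, ?_⟩) ?_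
    · rw [List.pairwise_map]
      refine (Finset.nodup_toList _).pairwise_of_forall_ne fun c _ c' _ hne v hv hv' => ?_
      exact hne (((hmem c v).1 hv).symm.trans ((hmem c' v).1 hv'))
    · simp only [List.mem_flatten, List.mem_map, exists_exists_and_eq_and]
      exact ⟨C.connectedComponentMk v, by simp, (hmem _ v).2 rfl⟩
  · simp [numCycles]
  · rw [numCycles, Nat.card_eq_fintype_card]
    exact Finset.card_image_le
  · intro e he
    induction e using Sym2.ind with
    | _ a b =>
      rcases hedge _ a b he rfl with hab | hab
      · exact .inl (Finset.mem_image.2 ⟨_, Finset.mem_univ _, hab.symm⟩)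
      · exact .inr ⟨l (C.connectedComponentMk a), List.mem_map.2 ⟨_, by simp, rfl⟩, hab⟩

open Classical in
lemma IsTwoFactor.card_edgeFinset [Fintype V] {G C : SimpleGraph V} (h : IsTwoFactor G C) :
    C.edgeFinset.card = Fintype.card V := by
  have h2 := C.sum_degrees_eq_twice_card_edges
  have hdeg (v : V) : C.degree v = 2 := by
    rw [← card_neighborSet_eq_degree, ← Nat.card_eq_fintype_card, Nat.card_coe_set_eq, h.2 v]
  simp only [hdeg, Finset.sum_const, Finset.card_univ, smul_eq_mul] at h2
  omega

end GraphToCover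

section Iteration

variable {V : Type*} [Fintype V]

lemma IsCycleCover.exists_length_eq_add [DecidableEq V] {G : SimpleGraph V}
    (E : Finset (Sym2 V)) (A : Finset (Sym2 (Sym2 V)))
    (hA : ∀ s ∈ A, ∃ e ∈ E, ∃ e' ∈ E, s = s(e, e') ∧ e ≠ e' ∧
      ∃ x y z w, e = s(x, y) ∧ e' = s(z, w) ∧ G.Adj y z ∧ G.Adj w x)
    (m : ℕ) {L : List (List V)} (h : IsCycleCover G L) (R : Finset (Sym2 V))
    (hE : ∀ e ∈ E, e ∈ R ∨ ∃ l ∈ L, e ∈ pathEdges l)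
    (hcard : (R.card + 6 * m) * E.card + 16 * ((L.length + m) * Fintype.card V) < A.card) :
    ∃ L', IsCycleCover G L' ∧ L'.length = L.length + m := by
  induction m generalizing L R with
  | zero => exact ⟨L, h, rfl⟩
  | succ m ih =>
    obtain ⟨L₁, F, h₁, hlen, hF, hlost⟩ : HasAugmentation G L := by
      refine h.hasAugmentation_of_card_lt E R hE A hA (lt_of_le_of_lt ?_ hcard)
      gcongr <;> omega
    have hRF : (R ∪ F).card ≤ R.card + 6 := (Finset.card_union_le R F).trans (by omega)
    have hE₁ : ∀ e ∈ E, e ∈ R ∪ F ∨ ∃ l ∈ L₁, e ∈ pathEdges l := fun e he => by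
      rcases hE e he with hR | ⟨l, hl, hel⟩
      · exact .inl (Finset.mem_union_left _ hR)
      · exact (hlost l hl e hel).imp_left (Finset.mem_union_right _)
    obtain ⟨L', h', hlen'⟩ := ih h₁ (R ∪ F) hE₁ (lt_of_le_of_lt
      (Nat.add_le_add (Nat.mul_le_mul_right _ (by omega))
        (Nat.mul_le_mul_left _ (Nat.mul_le_mul_right _ (by omega)))) hcard)
    exact ⟨L', h', by omega⟩

lemma IsTwoFactor.exists_numCycles_eq_add {G C : SimpleGraph V} (h : IsTwoFactor G C) (m : ℕ)
    (hcard : (numCycles C + 6 * m) * Fintype.card V + 16 * ((numCycles C + m) * Fintype.card V)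
      < auxEdgeCount G C) :
    ∃ H, IsTwoFactor G H ∧ numCycles H = numCycles C + m := by
  classical
  obtain ⟨L, R, hL, hlen, hR, hE⟩ := h.exists_isCycleCover
  have hfin := Set.toFinite {q : Sym2 (Sym2 V) | ∃ e e', AuxAdj G C e e' ∧ q = s(e, e')}
  rw [auxEdgeCount, Set.ncard_eq_toFinset_card _ hfin] at hcard
  have hA : ∀ s ∈ hfin.toFinset, ∃ e ∈ C.edgeFinset, ∃ e' ∈ C.edgeFinset, s = s(e, e') ∧ e ≠ e' ∧
      ∃ x y z w, e = s(x, y) ∧ e' = s(z, w) ∧ G.Adj y z ∧ G.Adj w x := fun s hs => by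
    obtain ⟨e, e', ⟨he, he', hne, -, x, y, z, w, hxy, hzw, hyz, hwx, -⟩, rfl⟩ :=
      hfin.mem_toFinset.1 hs
    exact ⟨e, mem_edgeFinset.2 he, e', mem_edgeFinset.2 he', rfl, hne,
      x, y, z, w, hxy, hzw, hyz, hwx⟩
  obtain ⟨L', hL', hlen'⟩ := hL.exists_length_eq_add C.edgeFinset hfin.toFinset hA m R
    (fun e he => hE e (mem_edgeFinset.1 he))
    (lt_of_le_of_lt (by rw [hlen, h.card_edgeFinset]; gcongr) hcard)
  exact ⟨cyclicGraph L', hL'.isTwoFactor, by rw [hL'.numCycles_cyclicGraph, hlen', hlen]⟩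

end Iteration

theorem stmt12 (δ : ℝ) (hδ0 : 0 < δ) (hδ1 : δ ≤ 1) :
    ∃ η₀ : ℝ, 0 < η₀ ∧ ∀ η : ℝ, 0 < η → η ≤ η₀ →
      ∃ n₀ : ℕ, ∀ n : ℕ, n₀ ≤ n →
        ∀ (G C : SimpleGraph (Fin n)) (ℓ k : ℕ),
          IsTwoFactor G C → numCycles C = ℓ → 1 ≤ ℓ → (ℓ : ℝ) ≤ (n : ℝ) ^ (1 - δ) →
          (n : ℝ) ^ (2 - η) ≤ (auxEdgeCount G C : ℝ) →
          ℓ ≤ k → (k : ℝ) ≤ (n : ℝ) ^ (1 - δ) →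
          ∃ H : SimpleGraph (Fin n), IsTwoFactor G H ∧ numCycles H = k := by
  refine ⟨δ / 2, by positivity, fun η hη0 hη => ?_⟩
  obtain ⟨n₀, hn₀⟩ := (((tendsto_rpow_atTop (half_pos hδ0)).comp
    tendsto_natCast_atTop_atTop).eventually_gt_atTop 23).exists_forall_of_atTop
  refine ⟨n₀ + 1, fun n hn G C ℓ k hC hℓ _ hℓn haux hℓk hkn => ?_⟩
  obtain ⟨m, rfl⟩ := Nat.exists_eq_add_of_le hℓk
  subst hℓ
  refine hC.exists_numCycles_eq_add m ?_
  have hlarge : (23 : ℝ) < (n : ℝ) ^ (δ / 2) := hn₀ n (by omega)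
  have hn1 : (1 : ℝ) ≤ n := by exact_mod_cast (by omega : 1 ≤ n)
  have hn0 : (0 : ℝ) < n := by linarith
  rw [Fintype.card_fin, ← Nat.cast_lt (α := ℝ)]
  push_cast at hkn ⊢
  calc ((numCycles C : ℝ) + 6 * m) * n + 16 * ((numCycles C + m) * n)
      ≤ 23 * ((n : ℝ) ^ (1 - δ) * n) := by
        have : (0 : ℝ) ≤ numCycles C := Nat.cast_nonneg _
        nlinarith
    _ = 23 * (n : ℝ) ^ (2 - δ) := by
        rw [← Real.rpow_add_one hn0.ne']
        ring_nf
    _ < (n : ℝ) ^ (δ / 2) * (n : ℝ) ^ (2 - δ) := by gcongr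
    _ = (n : ℝ) ^ (2 - δ / 2) := by
        rw [← Real.rpow_add hn0]
        ring_nf
    _ ≤ (n : ℝ) ^ (2 - η) := Real.rpow_le_rpow_of_exponent_le hn1 (by linarith)
    _ ≤ auxEdgeCount G C := haux
end
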